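/- arXiv:1106.3758 — 7 statements merged into one kernel-verified Lean document; each statement's English description precedes it below -/
import Mathlib

section
/- For every n ∈ ℤ, the linear recurrence x_{n+1} = z·x_n − x_{n−1} holds in K. -/
noncomputable section

/-- The ambient field `K = ℚ(a,b)`, the field of rational functions in two
independent variables over `ℚ`. -/
abbrev K : Type := FractionRing (MvPolynomial (Fin 2) ℚ)

/-- The first variable `a`. -/
def a : K := algebraMap (MvPolynomial (Fin 2) ℚ) K (MvPolynomial.X 0)

/-- The second variable `b`. -/
def b : K := algebraMap (MvPolynomial (Fin 2) ℚ) K (MvPolynomial.X 1)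

/-- Forward Kronecker sequence: `fwd n = x_n` for `n ≥ 0`, with
`x_0 = a`, `x_1 = b` and `x_{n+1} = (x_n² + 1)/x_{n−1}`. -/
def fwd : ℕ → K
  | 0 => a
  | 1 => b
  | n + 2 => (fwd (n + 1) ^ 2 + 1) / fwd n

/-- Backward Kronecker sequence: `bwd n = x_{-n}` for `n ≥ 0`, using
`x_{n−1} = (x_n² + 1)/x_{n+1}` for `n ≤ 0`. -/
def bwd : ℕ → K
  | 0 => a
  | 1 => (a ^ 2 + 1) / b
  | n + 2 => (bwd (n + 1) ^ 2 + 1) / bwd n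

/-- The Kronecker cluster variables `x : ℤ → K` of the coefficient-free cluster
algebra of type `Ã_{1,1}`. -/
def xK (n : ℤ) : K := if 0 ≤ n then fwd n.toNat else bwd (-n).toNat

/-- The element attached to the simple loop in the annulus `C_{1,1}`:
`z = (1 + a² + b²)/(a·b)`. -/
def zK : K := (1 + a ^ 2 + b ^ 2) / (a * b)

/-- Evaluating a relation `p² + q² = 0` at rational points shows that `-1` is not a square in `K`. -/
theorem sq_add_one_ne_zero (x : K) : x ^ 2 + 1 ≠ 0 := by
  obtain ⟨p, q, hq, rfl⟩ := IsFractionRing.div_surjective (A := MvPolynomial (Fin 2) ℚ) x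
  have hq0 : q ≠ 0 := nonZeroDivisors.ne_zero hq
  have hqK : algebraMap (MvPolynomial (Fin 2) ℚ) K q ≠ 0 := by simpa using hq0
  intro h
  have hK : algebraMap (MvPolynomial (Fin 2) ℚ) K (p ^ 2 + q ^ 2) = 0 := by
    field_simp at h
    simpa using h
  have hpq : p ^ 2 + q ^ 2 = 0 := by
    simpa only [map_zero] using
      IsFractionRing.injective (MvPolynomial (Fin 2) ℚ) K (hK.trans (map_zero _).symm)
  apply hq0
  refine MvPolynomial.funext fun v => ?_
  have hv := congrArg (MvPolynomial.eval v) hpq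
  simp only [map_add, map_pow, map_zero] at hv ⊢
  nlinarith [sq_nonneg (MvPolynomial.eval v p), sq_nonneg (MvPolynomial.eval v q)]

/-- The quantity `(1 + uₙ² + uₙ₊₁²) / (uₙ uₙ₊₁)` is conserved by `uₙ₊₂ = (uₙ₊₁² + 1) / uₙ`. -/
theorem conserved_of_exchange {F : Type*} [Field F] (hF : ∀ x : F, x ^ 2 + 1 ≠ 0)
    {u : ℕ → F} (hu : ∀ n, u (n + 2) = (u (n + 1) ^ 2 + 1) / u n)
    (h0 : u 0 ≠ 0) (h1 : u 1 ≠ 0) {z : F} (hz : z * u 0 * u 1 = 1 + u 0 ^ 2 + u 1 ^ 2) (n : ℕ) :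
    u n ≠ 0 ∧ u (n + 1) ≠ 0 ∧ z * u n * u (n + 1) = 1 + u n ^ 2 + u (n + 1) ^ 2 := by
  induction n with
  | zero => exact ⟨h0, h1, hz⟩
  | succ n ih =>
    obtain ⟨hn, hn', hzn⟩ := ih
    refine ⟨hn', ?_, ?_⟩
    · rw [hu n]
      exact div_ne_zero (hF _) hn
    · have hmul : u (n + 2) * u n = u (n + 1) ^ 2 + 1 := by rw [hu n, div_mul_cancel₀ _ hn]
      apply mul_right_cancel₀ hn
      linear_combination u (n + 2) * hzn + (u n - u (n + 2)) * hmul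

/-- A solution of the exchange relation satisfies a three-term linear recurrence. -/
theorem linear_recurrence_of_exchange {F : Type*} [Field F] (hF : ∀ x : F, x ^ 2 + 1 ≠ 0)
    {u : ℕ → F} (hu : ∀ n, u (n + 2) = (u (n + 1) ^ 2 + 1) / u n)
    (h0 : u 0 ≠ 0) (h1 : u 1 ≠ 0) {z : F} (hz : z * u 0 * u 1 = 1 + u 0 ^ 2 + u 1 ^ 2) (n : ℕ) :
    u (n + 2) = z * u (n + 1) - u n := by
  obtain ⟨hn, -, hzn⟩ := conserved_of_exchange hF hu h0 h1 hz n
  rw [hu n, div_eq_iff hn]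
  linear_combination -hzn

theorem a_ne_zero : a ≠ 0 := by simp [a]

theorem b_ne_zero : b ≠ 0 := by simp [b]

theorem fwd_linear_recurrence (n : ℕ) : fwd (n + 2) = zK * fwd (n + 1) - fwd n := by
  have ha := a_ne_zero
  have hb := b_ne_zero
  refine linear_recurrence_of_exchange sq_add_one_ne_zero (fun n => by rw [fwd]) ?_ ?_ ?_ n
  · simpa only [fwd] using ha
  · simpa only [fwd] using hb
  · simp only [fwd, zK]
    field_simp

theorem bwd_linear_recurrence (n : ℕ) : bwd (n + 2) = zK * bwd (n + 1) - bwd n := by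
  have ha := a_ne_zero
  have hb := b_ne_zero
  refine linear_recurrence_of_exchange sq_add_one_ne_zero (fun n => by rw [bwd]) ?_ ?_ ?_ n
  · simpa only [bwd] using ha
  · simpa only [bwd] using div_ne_zero (sq_add_one_ne_zero a) hb
  · simp only [bwd, zK]
    field_simp
    ring

theorem xK_natCast (n : ℕ) : xK n = fwd n := by simp [xK]

theorem xK_neg_natCast (n : ℕ) : xK (-n) = bwd n := by
  cases n with
  | zero => simp [xK, fwd, bwd]
  | succ n =>
    rw [xK, if_neg (by lia), neg_neg, Int.toNat_natCast]

theorem xK_linear_recurrence_zero : xK 1 = zK * xK 0 - xK (-1) := by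
  have ha := a_ne_zero
  have hb := b_ne_zero
  have hneg := xK_neg_natCast 1
  have hpos := xK_natCast 1
  have hzero := xK_natCast 0
  simp only [Nat.cast_one, Nat.cast_zero, fwd, bwd] at hneg hpos hzero
  rw [hneg, hpos, hzero, zK]
  field_simp
  ring

/-- The linear recurrence `x_{n+1} = z·x_n − x_{n−1}` holds in `K` for every `n ∈ ℤ`. -/
theorem xK_linear_recurrence (n : ℤ) :
    xK (n + 1) = zK * xK n - xK (n - 1) := by
  obtain ⟨m, rfl | rfl⟩ := n.eq_nat_or_neg
  · cases m with
    | zero => simpa using xK_linear_recurrence_zero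
    | succ m =>
      have h := fwd_linear_recurrence m
      simp only [← xK_natCast] at h
      have hr : ((m + 1 : ℕ) : ℤ) - 1 = m := by push_cast; ring
      rw [hr]
      exact_mod_cast h
  · cases m with
    | zero => simpa using xK_linear_recurrence_zero
    | succ m =>
      have h := bwd_linear_recurrence m
      simp only [← xK_neg_natCast] at h
      have hl : -((m + 1 : ℕ) : ℤ) + 1 = -(m : ℤ) := by push_cast; ring
      have hr : -((m + 1 : ℕ) : ℤ) - 1 = -((m + 2 : ℕ) : ℤ) := by push_cast; ring
      rw [hl, hr, h]
      ring
end
end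

section
/- For all m, n ∈ ℤ, the cluster variable x_m is a nonnegative Laurent polynomial in (x_n, x_{n+1}); consequently every cluster monomial x_m^p·x_{m+1}^q (p, q ∈ ℕ) is a nonnegative Laurent polynomial in every cluster (x_n, x_{n+1}). (This is the type Ã_{1,1} instance of positivity property (B2) for cluster monomials.) -/
noncomputable section

/-- `y ∈ K` is a nonnegative Laurent polynomial in `(u, v)`: there are `k, l ∈ ℕ`
and a two-variable polynomial `P` with nonnegative integer coefficients such that
`y·u^k·v^l = P(u,v)`. -/
def IsNonnegLaurent (u v y : K) : Prop :=
  ∃ (k l : ℕ) (P : MvPolynomial (Fin 2) ℕ),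
    y * u ^ k * v ^ l = MvPolynomial.eval₂ (Nat.castRingHom K) ![u, v] P

theorem fwd_ne_zero : ∀ n, fwd n ≠ 0
  | 0 => by simpa [fwd] using a_ne_zero
  | 1 => by simpa [fwd] using b_ne_zero
  | n + 2 => by
    rw [fwd]
    exact div_ne_zero (sq_add_one_ne_zero _) (fwd_ne_zero n)

theorem bwd_ne_zero : ∀ n, bwd n ≠ 0
  | 0 => by simpa [bwd] using a_ne_zero
  | 1 => by
    rw [bwd]
    exact div_ne_zero (sq_add_one_ne_zero _) b_ne_zero
  | n + 2 => by
    rw [bwd]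
    exact div_ne_zero (sq_add_one_ne_zero _) (bwd_ne_zero n)

theorem xK_ne_zero (n : ℤ) : xK n ≠ 0 := by
  rw [xK]
  split_ifs
  exacts [fwd_ne_zero _, bwd_ne_zero _]

theorem xK_exchange_zero : xK 1 * xK (-1) = xK 0 ^ 2 + 1 := by
  have h₁ : xK 1 = b := by simpa [fwd] using xK_natCast 1
  have h₂ : xK (-1) = (a ^ 2 + 1) / b := by simpa [bwd] using xK_neg_natCast 1
  have h₀ : xK 0 = a := by simpa [fwd] using xK_natCast 0
  rw [h₀, h₁, h₂, mul_div_cancel₀ _ b_ne_zero]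

/-- The exchange relation between neighbouring clusters. -/
theorem xK_exchange (n : ℤ) : xK (n + 1) * xK (n - 1) = xK n ^ 2 + 1 := by
  obtain ⟨k, rfl | rfl⟩ := n.eq_nat_or_neg
  · rcases k with _ | k
    · simpa using xK_exchange_zero
    · rw [show ((k + 1 : ℕ) : ℤ) + 1 = (k + 2 : ℕ) by push_cast; ring,
        show ((k + 1 : ℕ) : ℤ) - 1 = (k : ℕ) by push_cast; ring,
        xK_natCast, xK_natCast, xK_natCast, fwd, div_mul_cancel₀ _ (fwd_ne_zero k)]
  · rcases k with _ | k
    · simpa using xK_exchange_zero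
    · rw [show -((k + 1 : ℕ) : ℤ) + 1 = -(k : ℕ) by push_cast; ring,
        show -((k + 1 : ℕ) : ℤ) - 1 = -((k + 2 : ℕ) : ℤ) by push_cast; ring,
        xK_neg_natCast, xK_neg_natCast, xK_neg_natCast, bwd,
        mul_div_cancel₀ _ (bwd_ne_zero k)]

/-- The nonnegative Laurent polynomials in `(u, v)` form a subsemiring of `K`. -/
def nonnegLaurent (u v : K) : Subsemiring K where
  carrier := {y | IsNonnegLaurent u v y}
  zero_mem' := ⟨0, 0, 0, by simp⟩
  one_mem' := ⟨0, 0, 1, by simp⟩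
  add_mem' := by
    rintro y y' ⟨k, l, P, h⟩ ⟨k', l', P', h'⟩
    refine ⟨k + k', l + l', P * MvPolynomial.X 0 ^ k' * MvPolynomial.X 1 ^ l' +
      P' * MvPolynomial.X 0 ^ k * MvPolynomial.X 1 ^ l, ?_⟩
    simp only [MvPolynomial.eval₂_add, MvPolynomial.eval₂_mul, MvPolynomial.eval₂_pow,
      MvPolynomial.eval₂_X, ← h, ← h', Matrix.cons_val_zero, Matrix.cons_val_one]
    ring
  mul_mem' := by
    rintro y y' ⟨k, l, P, h⟩ ⟨k', l', P', h'⟩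
    refine ⟨k + k', l + l', P * P', ?_⟩
    rw [MvPolynomial.eval₂_mul, ← h, ← h']
    ring

theorem mem_nonnegLaurent {u v y : K} : y ∈ nonnegLaurent u v ↔ IsNonnegLaurent u v y :=
  Iff.rfl

theorem left_mem_nonnegLaurent (u v : K) : u ∈ nonnegLaurent u v :=
  ⟨0, 0, MvPolynomial.X 0, by simp⟩

theorem right_mem_nonnegLaurent (u v : K) : v ∈ nonnegLaurent u v :=
  ⟨0, 0, MvPolynomial.X 1, by simp⟩

theorem left_inv_mem_nonnegLaurent {u : K} (v : K) (hu : u ≠ 0) : u⁻¹ ∈ nonnegLaurent u v :=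
  ⟨1, 0, 1, by simp [hu]⟩

theorem right_inv_mem_nonnegLaurent (u : K) {v : K} (hv : v ≠ 0) : v⁻¹ ∈ nonnegLaurent u v :=
  ⟨0, 1, 1, by simp [hv]⟩

/-- Along a solution of the exchange relation, `(y_n² + y_{n+1}² + 1) / (y_n y_{n+1})`
does not depend on `n`. -/
theorem exchange_invariant {F : Type*} [Field F] {y : ℕ → F} (hy : ∀ n, y n ≠ 0)
    (hex : ∀ n, y (n + 2) * y n = y (n + 1) ^ 2 + 1) (n : ℕ) :
    (y n ^ 2 + y (n + 1) ^ 2 + 1) * (y 0 * y 1) =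
      (y 0 ^ 2 + y 1 ^ 2 + 1) * (y n * y (n + 1)) := by
  induction n with
  | zero => rfl
  | succ n ih =>
    apply mul_left_cancel₀ (hy n)
    linear_combination y (n + 2) * ih +
      (y 0 * y 1 * (y (n + 2) - y n)) * hex n

/-- A solution of the exchange relation lies in every subsemiring containing its first two
terms and their inverses. -/
theorem mem_of_exchange {F : Type*} [Field F] {y : ℕ → F} (hy : ∀ n, y n ≠ 0)
    (hex : ∀ n, y (n + 2) * y n = y (n + 1) ^ 2 + 1) (S : Subsemiring F)
    (h0 : y 0 ∈ S) (h1 : y 1 ∈ S) (h0' : (y 0)⁻¹ ∈ S) (h1' : (y 1)⁻¹ ∈ S) (n : ℕ) :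
    y n ∈ S := by
  -- Subtraction-free form of the linear recurrence, in terms of `y n` and
  -- `w n = y (n + 1) - (y 1 / y 0) * y n`.
  suffices h : y n ∈ S ∧ y (n + 1) - y 1 * (y 0)⁻¹ * y n ∈ S from h.1
  induction n with
  | zero =>
    refine ⟨h0, ?_⟩
    simp [hy 0]
  | succ n ih =>
    obtain ⟨hyn, hwn⟩ := ih
    constructor
    · convert S.add_mem (S.mul_mem (S.mul_mem h1 h0') hyn) hwn using 1
      ring
    · convert S.add_mem (S.mul_mem (S.mul_mem h0' h0') hyn)
        (S.mul_mem (S.add_mem (S.mul_mem h0 h1') (S.mul_mem h0' h1')) hwn) using 1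
      have hinv := exchange_invariant hy hex n
      have := hy 0
      have := hy 1
      have hlin : (y (n + 2) + y n) * (y 0 * y 1) =
          (y 0 ^ 2 + y 1 ^ 2 + 1) * y (n + 1) := by
        apply mul_left_cancel₀ (hy n)
        linear_combination hinv + y 0 * y 1 * hex n
      have hz : y (n + 2) = (y 0 ^ 2 + y 1 ^ 2 + 1) * y (n + 1) / (y 0 * y 1) - y n := by
        rw [← hlin]
        field_simp
        ring
      rw [hz]
      field_simp
      ring

theorem xK_mem_nonnegLaurent (m n : ℤ) : xK m ∈ nonnegLaurent (xK n) (xK (n + 1)) := by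
  have hu := left_mem_nonnegLaurent (xK n) (xK (n + 1))
  have hv := right_mem_nonnegLaurent (xK n) (xK (n + 1))
  have hu' := left_inv_mem_nonnegLaurent (xK (n + 1)) (xK_ne_zero n)
  have hv' := right_inv_mem_nonnegLaurent (xK n) (xK_ne_zero (n + 1))
  rcases le_total n m with h | h
  · obtain ⟨k, rfl⟩ := Int.le.dest h
    refine mem_of_exchange (y := fun j : ℕ => xK (n + j)) (fun _ => xK_ne_zero _) (fun j => ?_) _
      (by simpa using hu) (by simpa using hv) (by simpa using hu') (by simpa using hv') k
    convert xK_exchange (n + (j + 1 : ℕ)) using 3 <;> push_cast <;> ring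
  · obtain ⟨k, rfl⟩ := Int.le.dest h
    have := mem_of_exchange (y := fun j : ℕ => xK (m + k + 1 - j)) (fun _ => xK_ne_zero _)
      (fun j => ?_) _ (by simpa using hv) (by simpa using hu) (by simpa using hv')
      (by simpa using hu') (k + 1)
    · convert this using 2
      push_cast
      ring
    · rw [mul_comm]
      convert xK_exchange (m + k + 1 - (j + 1 : ℕ)) using 3 <;> push_cast <;> ring

/-- For all `m, n ∈ ℤ`, the cluster variable `x_m` is a nonnegative Laurent
polynomial in the cluster `(x_n, x_{n+1})`; consequently every cluster monomial
`x_m^p·x_{m+1}^q` is a nonnegative Laurent polynomial in every cluster. -/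
theorem cluster_monomials_positive :
    (∀ m n : ℤ, IsNonnegLaurent (xK n) (xK (n + 1)) (xK m)) ∧
    (∀ m n : ℤ, ∀ p q : ℕ,
      IsNonnegLaurent (xK n) (xK (n + 1)) (xK m ^ p * xK (m + 1) ^ q)) := by
  exact ⟨xK_mem_nonnegLaurent, fun m n p q => mem_nonnegLaurent.mp <|
    mul_mem (pow_mem (xK_mem_nonnegLaurent m n) p)
      (pow_mem (xK_mem_nonnegLaurent (m + 1) n) q)⟩
end
end

section
/- For every integer m ≥ 1 and every n ∈ ℤ, the element F_m(z) ∈ K is a nonnegative Laurent polynomial in (x_n, x_{n+1}); in fact (x_n·x_{n+1})^m·F_m(z) is a polynomial in x_n and x_{n+1} with nonnegative integer coefficients. (This is the type Ã_{1,1} instance of positivity property (B2) for the loop elements x_{z_m} = F_m(X_δ).) -/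
noncomputable section

/-- The `m`-th normalised Chebyshev polynomial of the first kind:
`F_0 = 2`, `F_1 = X`, `F_{m+1} = X·F_m − F_{m−1}`. -/
def chebF : ℕ → Polynomial ℤ
  | 0 => 2
  | 1 => Polynomial.X
  | n + 2 => Polynomial.X * chebF (n + 1) - chebF n

/-- The pair `(u, v)` consists of nonzero elements and expresses the loop element `zK` by the same
formula as the initial cluster `(a, b)`. -/
def IsLoopPair (u v : K) : Prop :=
  u ≠ 0 ∧ v ≠ 0 ∧ zK * (u * v) = 1 + u ^ 2 + v ^ 2

theorem IsLoopPair.symm {u v : K} (h : IsLoopPair u v) : IsLoopPair v u :=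
  ⟨h.2.1, h.1, by linear_combination h.2.2⟩

theorem isLoopPair_a_b : IsLoopPair a b :=
  ⟨a_ne_zero, b_ne_zero, div_mul_cancel₀ _ (mul_ne_zero a_ne_zero b_ne_zero)⟩

/-- Mutation preserves loop pairs. -/
theorem IsLoopPair.mutate {u v : K} (h : IsLoopPair u v) : IsLoopPair v ((v ^ 2 + 1) / u) := by
  obtain ⟨hu, hv, hz⟩ := h
  refine ⟨hv, div_ne_zero (sq_add_one_ne_zero v) hu, ?_⟩
  field_simp
  linear_combination (v ^ 2 + 1) * hz

theorem isLoopPair_fwd (n : ℕ) : IsLoopPair (fwd n) (fwd (n + 1)) := by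
  induction n with
  | zero => simpa only [fwd] using isLoopPair_a_b
  | succ n ih => simpa only [fwd] using ih.mutate

theorem isLoopPair_bwd (n : ℕ) : IsLoopPair (bwd n) (bwd (n + 1)) := by
  induction n with
  | zero => simpa only [bwd] using isLoopPair_a_b.symm.mutate
  | succ n ih => simpa only [bwd] using ih.mutate

/-- Every cluster is a loop pair. -/
theorem isLoopPair_xK (n : ℤ) : IsLoopPair (xK n) (xK (n + 1)) := by
  obtain ⟨k, rfl | rfl⟩ : ∃ k : ℕ, n = k ∨ n = -(k + 1 : ℤ) := by
    rcases le_or_gt 0 n with h | h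
    · exact ⟨n.toNat, by omega⟩
    · exact ⟨(-n - 1).toNat, by omega⟩
  · have h₁ : xK k = fwd k := by simp [xK]
    have h₂ : xK (k + 1) = fwd (k + 1) := by
      rw [xK, if_pos (by omega)]
      congr 1
    rw [h₁, h₂]
    exact isLoopPair_fwd k
  · have h₁ : xK (-(k + 1 : ℤ)) = bwd (k + 1) := by
      rw [xK, if_neg (by omega)]
      congr 1
    have h₂ : xK (-(k + 1 : ℤ) + 1) = bwd k := by
      cases k with
      | zero => simp [xK, fwd, bwd]
      | succ k =>
        rw [xK, if_neg (by omega)]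
        congr 1
    rw [h₁, h₂]
    exact (isLoopPair_bwd k).symm

/-- A matrix with trace `1 + u ^ 2 + v ^ 2` and determinant `u ^ 2 * v ^ 2`, all of whose entries
are polynomials in `u`, `v` with nonnegative coefficients. -/
def loopMatrix {R : Type*} [CommSemiring R] (u v : R) : Matrix (Fin 2) (Fin 2) R :=
  !![1 + u ^ 2, v ^ 2; 1, v ^ 2]

theorem trace_loopMatrix_pow_add_two {R : Type*} [CommRing R] (u v : R) (m : ℕ) :
    (loopMatrix u v ^ (m + 2)).trace =
      (1 + u ^ 2 + v ^ 2) * (loopMatrix u v ^ (m + 1)).trace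
        - (u * v) ^ 2 * (loopMatrix u v ^ m).trace := by
  have h : loopMatrix u v ^ 2 =
      (1 + u ^ 2 + v ^ 2) • loopMatrix u v - (u * v) ^ 2 • (1 : Matrix (Fin 2) (Fin 2) R) := by
    ext i j
    fin_cases i <;> fin_cases j <;>
      simp [loopMatrix, pow_two, Matrix.mul_apply, Fin.sum_univ_two] <;> ring
  rw [pow_add, h, mul_sub, Matrix.mul_smul, Matrix.mul_smul, ← pow_succ, mul_one,
    Matrix.trace_sub, Matrix.trace_smul, Matrix.trace_smul, smul_eq_mul, smul_eq_mul]

/-- The loop elements, cleared of denominators, are traces of powers of the loop matrix. -/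
theorem IsLoopPair.mul_pow_mul_aeval_chebF {u v : K} (h : IsLoopPair u v) (m : ℕ) :
    (u * v) ^ m * Polynomial.aeval zK (chebF m) = (loopMatrix u v ^ m).trace := by
  induction m using Nat.twoStepInduction with
  | zero => simpa [chebF] using map_ofNat (Polynomial.aeval (R := ℤ) zK) 2
  | one =>
    simp only [chebF, pow_one, Polynomial.aeval_X, loopMatrix, Matrix.trace_fin_two_of]
    linear_combination h.2.2
  | more m ih₀ ih₁ =>
    rw [trace_loopMatrix_pow_add_two, ← ih₀, ← ih₁, ← h.2.2]
    simp only [chebF, map_sub, map_mul, Polynomial.aeval_X]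
    ring

/-- The trace of a power of the loop matrix is a polynomial with nonnegative coefficients. -/
theorem eval₂_trace_loopMatrix_pow {R : Type*} [CommSemiring R] (u v : R) (m : ℕ) :
    MvPolynomial.eval₂ (Nat.castRingHom R) ![u, v]
        (loopMatrix (MvPolynomial.X 0) (MvPolynomial.X 1) ^ m).trace =
      (loopMatrix u v ^ m).trace := by
  let f := MvPolynomial.eval₂Hom (Nat.castRingHom R) ![u, v]
  have hM : f.mapMatrix (loopMatrix (MvPolynomial.X 0) (MvPolynomial.X 1)) = loopMatrix u v := by
    ext i j
    fin_cases i <;> fin_cases j <;> simp [loopMatrix, f]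
  rw [← hM, ← map_pow]
  exact AddMonoidHom.map_trace f _

/-- For every `m ≥ 1` and every `n ∈ ℤ`, the loop element `F_m(z) ∈ K` is a
nonnegative Laurent polynomial in `(x_n, x_{n+1})`; in fact
`(x_n·x_{n+1})^m·F_m(z)` is a polynomial in `x_n` and `x_{n+1}` with nonnegative
integer coefficients. -/
theorem loop_elements_positive (m : ℕ) (hm : 1 ≤ m) (n : ℤ) :
    IsNonnegLaurent (xK n) (xK (n + 1)) (Polynomial.aeval zK (chebF m)) ∧
    ∃ P : MvPolynomial (Fin 2) ℕ,
      (xK n * xK (n + 1)) ^ m * Polynomial.aeval zK (chebF m) =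
        MvPolynomial.eval₂ (Nat.castRingHom K) ![xK n, xK (n + 1)] P := by
  obtain ⟨P, hP⟩ : ∃ P : MvPolynomial (Fin 2) ℕ,
      (xK n * xK (n + 1)) ^ m * Polynomial.aeval zK (chebF m) =
        MvPolynomial.eval₂ (Nat.castRingHom K) ![xK n, xK (n + 1)] P :=
    ⟨_, ((isLoopPair_xK n).mul_pow_mul_aeval_chebF m).trans
      (eval₂_trace_loopMatrix_pow _ _ m).symm⟩
  exact ⟨⟨m, m, P, by rw [← hP]; ring⟩, P, hP⟩
end
end

section
/- Let A be the subring of K generated by {x_n : n ∈ ℤ}, and let B = {x_n^p·x_{n+1}^q : n ∈ ℤ, p, q ∈ ℕ} ∪ {F_m(z) : m ≥ 1}. If y ∈ A is a nonnegative Laurent polynomial in (x_n, x_{n+1}) for every n ∈ ℤ, then y can be written as a finite ℕ-linear combination of elements of B. (This is property (B3) of the theorem that B_Q is the atomic basis, in the case p = q = 1: B is the atomic basis of the coefficient-free cluster algebra of type Ã_{1,1}.) -/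
noncomputable section

/-- The set `B = {x_n^p·x_{n+1}^q : n ∈ ℤ, p, q ∈ ℕ} ∪ {F_m(z) : m ≥ 1}`. -/
def atomicSet : Set K :=
  {y | ∃ (n : ℤ) (p q : ℕ), y = xK n ^ p * xK (n + 1) ^ q} ∪
    {y | ∃ m : ℕ, 1 ≤ m ∧ y = Polynomial.aeval zK (chebF m)}


/-! ### Cluster variables: algebraic independence and recurrences -/

theorem algebraicIndependent_pair_iff {u v : K} :
    AlgebraicIndependent ℚ ![u, v] ↔
      Transcendental ℚ v ∧ Transcendental (Algebra.adjoin ℚ {v}) u := by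
  have himage : (![u, v] : Fin 2 → K) '' {0}ᶜ = {v} := by
    have h : ({0}ᶜ : Set (Fin 2)) = {1} := by ext i; fin_cases i <;> simp
    rw [h, Set.image_singleton]
    rfl
  have : Subsingleton {j : Fin 2 // j ≠ 0} :=
    ⟨fun ⟨i, hi⟩ ⟨j, hj⟩ => Subtype.ext (by lia)⟩
  rw [AlgebraicIndependent.iff_transcendental_adjoin_image 0, himage,
    algebraicIndependent_singleton_iff ⟨1, one_ne_zero⟩]
  rfl

theorem AlgebraicIndependent.pair_swap {u v : K} (h : AlgebraicIndependent ℚ ![u, v]) :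
    AlgebraicIndependent ℚ ![v, u] := by
  have := h.comp (Equiv.swap (0 : Fin 2) 1) (Equiv.injective _)
  convert this using 1
  ext i
  fin_cases i <;> simp

theorem AlgebraicIndependent.pair_snd_ne_zero {u v : K}
    (h : AlgebraicIndependent ℚ ![u, v]) : v ≠ 0 := by
  rintro rfl
  exact (algebraicIndependent_pair_iff.1 h).1 isAlgebraic_zero

theorem AlgebraicIndependent.pair_fst_ne_zero {u v : K}
    (h : AlgebraicIndependent ℚ ![u, v]) : u ≠ 0 :=
  h.pair_swap.pair_snd_ne_zero

/-- Mutation preserves algebraic independence. -/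
theorem AlgebraicIndependent.pair_mutate {u v : K} (h : AlgebraicIndependent ℚ ![u, v]) :
    AlgebraicIndependent ℚ ![v, (v ^ 2 + 1) / u] := by
  have hu := h.pair_fst_ne_zero
  obtain ⟨hv, huv⟩ := algebraicIndependent_pair_iff.1 h
  have hv1 : v ^ 2 + 1 ≠ 0 := by
    intro h0
    refine hv ⟨Polynomial.X ^ 2 + 1, ?_, by simpa using h0⟩
    exact (Polynomial.monic_X_pow_add_C (1 : ℚ) two_ne_zero).ne_zero
  refine (algebraicIndependent_pair_iff.2 ⟨hv, fun hw => huv ?_⟩).pair_swap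
  have hmem : v ^ 2 + 1 ∈ Algebra.adjoin ℚ {v} :=
    add_mem (pow_mem (Algebra.self_mem_adjoin_singleton ℚ v) 2) (one_mem _)
  have halg : IsAlgebraic (Algebra.adjoin ℚ {v}) (v ^ 2 + 1) :=
    isAlgebraic_algebraMap (⟨v ^ 2 + 1, hmem⟩ : Algebra.adjoin ℚ {v})
  have hmul := halg.mul hw.inv
  rwa [inv_div, mul_div_cancel₀ _ hv1] at hmul

theorem algebraicIndependent_a_b : AlgebraicIndependent ℚ ![a, b] := by
  have h := (MvPolynomial.algebraicIndependent_X (Fin 2) ℚ).map'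
    (f := IsScalarTower.toAlgHom ℚ (MvPolynomial (Fin 2) ℚ) K)
    (IsFractionRing.injective (MvPolynomial (Fin 2) ℚ) K)
  convert h using 1
  ext i
  fin_cases i <;> rfl

theorem algebraicIndependent_fwd (n : ℕ) :
    AlgebraicIndependent ℚ ![fwd n, fwd (n + 1)] := by
  induction n with
  | zero => exact algebraicIndependent_a_b
  | succ n ih => exact ih.pair_mutate

theorem algebraicIndependent_bwd (n : ℕ) :
    AlgebraicIndependent ℚ ![bwd n, bwd (n + 1)] := by
  induction n with
  | zero => exact algebraicIndependent_a_b.pair_swap.pair_mutate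
  | succ n ih => exact ih.pair_mutate

theorem algebraicIndependent_xK (n : ℤ) : AlgebraicIndependent ℚ ![xK n, xK (n + 1)] := by
  obtain ⟨m, rfl | rfl⟩ : ∃ m : ℕ, n = m ∨ n = -(m + 1 : ℕ) := by
    rcases le_or_gt 0 n with h | h
    · exact ⟨n.toNat, by lia⟩
    · exact ⟨(-n - 1).toNat, by lia⟩
  · have := algebraicIndependent_fwd m
    rwa [← xK_natCast, ← xK_natCast, Nat.cast_succ] at this
  · have := (algebraicIndependent_bwd m).pair_swap
    rwa [← xK_neg_natCast, ← xK_neg_natCast,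
      show (-(m : ℤ)) = -((m + 1 : ℕ) : ℤ) + 1 by push_cast; ring] at this

theorem xK_mul_xK_add_two (n : ℤ) : xK n * xK (n + 2) = xK (n + 1) ^ 2 + 1 := by
  obtain ⟨m, rfl | rfl | rfl⟩ : ∃ m : ℕ, n = m ∨ n = -1 ∨ n = -(m + 2 : ℕ) := by
    rcases le_or_gt 0 n with h | h
    · exact ⟨n.toNat, by lia⟩
    · exact ⟨(-n - 2).toNat, by lia⟩
  · have h : fwd (m + 2) = (fwd (m + 1) ^ 2 + 1) / fwd m := rfl
    have h0 := xK_ne_zero m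
    simp only [← xK_natCast] at h
    push_cast at h
    rw [h]
    field_simp
  · have h1 : xK (-1) = bwd 1 := xK_neg_natCast 1
    have h2 : xK (-1 + 2) = b := xK_natCast 1
    have h3 : xK (-1 + 1) = a := xK_natCast 0
    have hb := algebraicIndependent_a_b.pair_snd_ne_zero
    rw [h1, h2, h3, bwd]
    field_simp
  · have h : bwd (m + 2) = (bwd (m + 1) ^ 2 + 1) / bwd m := rfl
    have h0 := xK_ne_zero (-m)
    simp only [← xK_neg_natCast] at h
    rw [h, show -((m + 2 : ℕ) : ℤ) + 2 = -m by push_cast; ring,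
      show -((m + 2 : ℕ) : ℤ) + 1 = -(m + 1 : ℕ) by push_cast; ring]
    field_simp

/-- The element `z` is given by the same formula in every cluster. -/
theorem zK_mul_xK_mul_xK (n : ℤ) :
    zK * (xK n * xK (n + 1)) = 1 + xK n ^ 2 + xK (n + 1) ^ 2 := by
  induction n using Int.induction_on with
  | zero =>
    have h0 : xK 0 = a := xK_natCast 0
    have h1 : xK (0 + 1) = b := xK_natCast 1
    have ha := algebraicIndependent_a_b.pair_fst_ne_zero
    have hb := algebraicIndependent_a_b.pair_snd_ne_zero
    rw [h0, h1, zK]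
    field_simp
  | succ n ih =>
    have h := xK_mul_xK_add_two n
    refine mul_left_cancel₀ (xK_ne_zero n) ?_
    rw [add_assoc, show (1 + 1 : ℤ) = 2 from rfl]
    linear_combination xK (n + 2) * ih - (xK (n + 2) - xK n) * h
  | pred n ih =>
    have h := xK_mul_xK_add_two (-n - 1)
    rw [show -(n : ℤ) - 1 + 2 = -n + 1 by ring, show -(n : ℤ) - 1 + 1 = -n by ring] at h
    refine mul_left_cancel₀ (xK_ne_zero (-n + 1)) ?_
    rw [show -(n : ℤ) - 1 + 1 = -n by ring]
    linear_combination xK (-n - 1) * ih - (xK (-n - 1) - xK (-n + 1)) * h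

theorem zK_mul_xK (n : ℤ) : zK * xK n = xK (n + 1) + xK (n - 1) := by
  have h := xK_mul_xK_add_two (n - 1)
  have hz := zK_mul_xK_mul_xK n
  rw [show n - 1 + 2 = n + 1 by ring, sub_add_cancel] at h
  refine mul_left_cancel₀ (xK_ne_zero (n + 1)) ?_
  linear_combination hz - h

/-! ### The atoms span the cluster algebra -/

/-- The elements of `atomicSet`, indexed without repetition. -/
def atom : (ℤ × ℕ × ℕ) ⊕ ℕ → K
  | .inl (n, p, q) => xK n ^ (p + 1) * xK (n + 1) ^ q
  | .inr 0 => 1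
  | .inr (m + 1) => Polynomial.aeval zK (chebF (m + 1))

/-- The `ℤ`-span of the atoms. -/
def atomSpan : Submodule ℤ K := Submodule.span ℤ (Set.range atom)

theorem atom_mem_atomSpan (i : (ℤ × ℕ × ℕ) ⊕ ℕ) : atom i ∈ atomSpan :=
  Submodule.subset_span ⟨i, rfl⟩

theorem atom_mem_atomicSet (i : (ℤ × ℕ × ℕ) ⊕ ℕ) : atom i ∈ atomicSet := by
  rcases i with ⟨n, p, q⟩ | _ | m
  · exact Or.inl ⟨n, p + 1, q, rfl⟩
  · exact Or.inl ⟨0, 0, 0, by simp [atom]⟩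
  · exact Or.inr ⟨m + 1, by simp, rfl⟩

theorem one_mem_atomSpan : (1 : K) ∈ atomSpan := atom_mem_atomSpan (.inr 0)

theorem cluster_monomial_mem_atomSpan (n : ℤ) (p q : ℕ) :
    xK n ^ p * xK (n + 1) ^ q ∈ atomSpan := by
  rcases p with _ | p
  · rcases q with _ | q
    · simpa using one_mem_atomSpan
    · simpa [atom] using atom_mem_atomSpan (.inl (n + 1, q, 0))
  · exact atom_mem_atomSpan (.inl (n, p, q))

theorem zK_pow_mem_atomSpan (k : ℕ) : zK ^ k ∈ atomSpan := by
  let S : Submodule ℤ K := Submodule.span ℤ (Set.range fun m => atom (.inr m))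
  have hatom (m : ℕ) : atom (.inr m) ∈ S := Submodule.subset_span ⟨m, rfl⟩
  have hone : (1 : K) ∈ S := hatom 0
  have hcheb (m : ℕ) : Polynomial.aeval zK (chebF m) ∈ S := by
    rcases m with _ | m
    · have h : Polynomial.aeval zK (2 : Polynomial ℤ) = 2 := map_ofNat _ 2
      simpa [chebF, h] using S.smul_mem 2 hone
    · exact hatom (m + 1)
  have hmul : ∀ y ∈ S, zK * y ∈ S := by
    intro y hy
    induction hy using Submodule.span_induction with
    | mem y hy =>
      obtain ⟨m, rfl⟩ := hy
      rcases m with _ | m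
      · simpa [atom, chebF] using hatom 1
      · have h := add_mem (hcheb (m + 2)) (hcheb m)
        simpa [atom, chebF] using h
    | zero => simp
    | add y y' _ _ hy hy' => simpa [mul_add] using add_mem hy hy'
    | smul c y _ hy => simpa [mul_left_comm] using S.smul_mem c hy
  have hS : S ≤ atomSpan := Submodule.span_mono <| by
    rintro _ ⟨m, rfl⟩
    exact ⟨.inr m, rfl⟩
  refine hS ?_
  induction k with
  | zero => simpa using hone
  | succ k ih => simpa [pow_succ'] using hmul _ ih

/-- Two cluster variables may be moved closer together up to a polynomial in `z`. -/
theorem exists_xK_mul_xK_eq (m : ℕ) : ∃ r : Polynomial ℤ, ∀ n : ℤ,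
    xK n * xK (n + m + 1) = xK (n + 1) * xK (n + m) + Polynomial.aeval zK r := by
  induction m using Nat.twoStepInduction with
  | zero => exact ⟨0, fun n => by simp [mul_comm]⟩
  | one =>
    refine ⟨1, fun n => ?_⟩
    have h := xK_mul_xK_add_two n
    simp only [Nat.cast_one, map_one]
    rw [add_assoc, one_add_one_eq_two, h, sq]
  | more m ih₀ ih₁ =>
    obtain ⟨r₀, h₀⟩ := ih₀
    obtain ⟨r₁, h₁⟩ := ih₁
    refine ⟨Polynomial.X * r₁ - r₀, fun n => ?_⟩
    have hz := zK_mul_xK (n + m + 2)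
    have hz' := zK_mul_xK (n + m + 1)
    have e₀ := h₀ n
    have e₁ := h₁ n
    simp only [map_sub, map_mul, Polynomial.aeval_X]
    push_cast at *
    ring_nf at *
    linear_combination zK * e₁ - e₀ - xK n * hz + xK (1 + n) * hz'

/-- The product of the cluster variables indexed by a multiset. -/
def xProd (s : Multiset ℤ) : K := (s.map xK).prod

theorem xProd_cons (i : ℤ) (s : Multiset ℤ) : xProd (i ::ₘ s) = xK i * xProd s := by
  simp [xProd]

theorem xProd_eq_cluster_monomial {i : ℤ} {s : Multiset ℤ}
    (hs : ∀ j ∈ s, j = i ∨ j = i + 1) : ∃ p q : ℕ, xProd s = xK i ^ p * xK (i + 1) ^ q := by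
  induction s using Multiset.induction_on with
  | empty => exact ⟨0, 0, by simp [xProd]⟩
  | cons j s ih =>
    obtain ⟨p, q, h⟩ := ih fun k hk => hs k (Multiset.mem_cons_of_mem hk)
    rw [xProd_cons, h]
    rcases hs j (Multiset.mem_cons_self j s) with rfl | rfl
    · exact ⟨p + 1, q, by ring⟩
    · exact ⟨p, q + 1, by ring⟩

theorem aeval_zK_mul_xProd_mem_atomSpan {d : ℕ}
    (hd : ∀ s : Multiset ℤ, s.card = d → xProd s ∈ atomSpan)
    (r : Polynomial ℤ) {s : Multiset ℤ} (hs : s.card = d) :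
    Polynomial.aeval zK r * xProd s ∈ atomSpan := by
  have hpow (k : ℕ) : ∀ s : Multiset ℤ, s.card = d → zK ^ k * xProd s ∈ atomSpan := by
    induction k with
    | zero => simpa using hd
    | succ k ih =>
      intro s hs
      induction s using Multiset.induction_on with
      | empty => simpa [xProd] using zK_pow_mem_atomSpan (k + 1)
      | cons i s _ =>
        have h := add_mem (ih ((i + 1) ::ₘ s) (by simpa using hs))
          (ih ((i - 1) ::ₘ s) (by simpa using hs))
        have hz := zK_mul_xK i
        convert h using 1
        simp only [xProd_cons]
        linear_combination zK ^ k * xProd s * hz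
  rw [Polynomial.aeval_eq_sum_range, Finset.sum_mul]
  refine sum_mem fun k _ => ?_
  rw [Algebra.smul_def, eq_intCast, mul_assoc, ← zsmul_eq_mul]
  exact atomSpan.smul_mem _ (hpow k s hs)

theorem xProd_mem_atomSpan (s : Multiset ℤ) : xProd s ∈ atomSpan := by
  induction hd : s.card using Nat.strong_induction_on generalizing s with
  | _ d ihd =>
  induction hm : (s.map fun i => i.natAbs ^ 2).sum using Nat.strong_induction_on
    generalizing s with
  | _ m ihm =>
  by_cases hfar : ∃ i ∈ s, ∃ j ∈ s, i + 2 ≤ j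
  · obtain ⟨i, hi, j, hj, hij⟩ := hfar
    obtain ⟨t, rfl⟩ := Multiset.exists_cons_of_mem hi
    obtain ⟨t, rfl⟩ := Multiset.exists_cons_of_mem
      ((Multiset.mem_cons.1 hj).resolve_left (by lia))
    simp only [Multiset.card_cons] at hd
    simp only [Multiset.map_cons, Multiset.sum_cons] at hm
    obtain ⟨r, hr⟩ := exists_xK_mul_xK_eq (j - i - 1).toNat
    have hr := hr i
    rw [show i + ((j - i - 1).toNat : ℤ) = j - 1 by lia, sub_add_cancel] at hr
    have hlt : (i + 1).natAbs ^ 2 + (j - 1).natAbs ^ 2 < i.natAbs ^ 2 + j.natAbs ^ 2 := by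
      zify
      simp only [sq_abs]
      linarith
    have hnear := ihm _ (by simp only [Multiset.map_cons, Multiset.sum_cons]; lia)
      ((i + 1) ::ₘ (j - 1) ::ₘ t) (by simpa using hd) rfl
    have hrest := aeval_zK_mul_xProd_mem_atomSpan (fun s hs => ihd t.card (by lia) s hs) r
      (s := t) rfl
    convert add_mem hnear hrest using 1
    simp only [xProd_cons]
    linear_combination xProd t * hr
  · push Not at hfar
    rcases s.toFinset.eq_empty_or_nonempty with h0 | h0
    · rw [Multiset.toFinset_eq_empty.1 h0]
      simpa [xProd] using one_mem_atomSpan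
    · obtain ⟨i, hi, hmin⟩ := Finset.exists_min_image s.toFinset id h0
      simp only [Multiset.mem_toFinset, id] at hi hmin
      obtain ⟨p, q, h⟩ := xProd_eq_cluster_monomial (i := i) (s := s) fun j hj => by
        have := hmin j hj
        have := hfar i hi j hj
        lia
      rw [h]
      exact cluster_monomial_mem_atomSpan i p q

theorem closure_range_xK_subset_atomSpan {y : K} (hy : y ∈ Subring.closure (Set.range xK)) :
    y ∈ atomSpan := by
  rw [Subring.mem_closure_iff] at hy
  have hle : AddSubgroup.closure (Submonoid.closure (Set.range xK) : Set K) ≤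
      atomSpan.toAddSubgroup := by
    rw [AddSubgroup.closure_le]
    intro w hw
    obtain ⟨l, hl, rfl⟩ := Submonoid.exists_multiset_of_mem_closure hw
    obtain ⟨s, rfl⟩ : ∃ s : Multiset ℤ, s.map xK = l := by
      choose! f hf using hl
      exact ⟨l.map f, by
        rw [Multiset.map_map]
        exact (Multiset.map_congr rfl hf).trans (Multiset.map_id l)⟩
    exact xProd_mem_atomSpan s
  exact hle hy

/-! ### Laurent polynomials and weighted degrees -/

/-- Laurent polynomials in two variables with integer coefficients. -/
abbrev Laurent : Type := AddMonoidAlgebra ℤ (ℤ × ℤ)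

namespace Laurent

/-- The Laurent monomial with a given exponent vector. -/
def mono (e : ℤ × ℤ) : Laurent := AddMonoidAlgebra.single e 1

theorem mono_mul_mono (e e' : ℤ × ℤ) : mono e * mono e' = mono (e + e') := by
  simp [mono]

theorem mono_pow (e : ℤ × ℤ) (k : ℕ) : mono e ^ k = mono (k • e) := by
  simp [mono, AddMonoidAlgebra.single_pow]

theorem mono_zero : mono 0 = 1 := rfl

theorem coeff_mono (e e' : ℤ × ℤ) : (mono e).coeff e' = if e = e' then 1 else 0 := by
  rw [mono, AddMonoidAlgebra.coeff_single, Finsupp.single_apply]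

/-- All exponents of `f` have `w`-weight at most `r`. -/
def WeightLE (w : ℤ × ℤ →+ ℤ) (r : ℤ) (f : Laurent) : Prop :=
  ∀ e, r < w e → f.coeff e = 0

variable {w : ℤ × ℤ →+ ℤ} {r s : ℤ} {f g : Laurent}

theorem WeightLE.mono_right (h : WeightLE w r f) (hrs : r ≤ s) : WeightLE w s f :=
  fun e he => h e (hrs.trans_lt he)

theorem weightLE_zero : WeightLE w r 0 := fun _ _ => rfl

theorem weightLE_mono {e : ℤ × ℤ} (h : w e ≤ r) : WeightLE w r (mono e) := by
  intro e' he'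
  rw [coeff_mono, if_neg]
  rintro rfl
  lia

theorem WeightLE.add (hf : WeightLE w r f) (hg : WeightLE w r g) : WeightLE w r (f + g) :=
  fun e he => by simp [hf e he, hg e he]

theorem WeightLE.sub (hf : WeightLE w r f) (hg : WeightLE w r g) : WeightLE w r (f - g) :=
  fun e he => by simp [hf e he, hg e he]

theorem WeightLE.mul (hf : WeightLE w r f) (hg : WeightLE w s g) :
    WeightLE w (r + s) (f * g) := by
  intro e he
  by_contra h
  obtain ⟨e₁, h₁, e₂, h₂, rfl⟩ := Finset.mem_add.1
    (AddMonoidAlgebra.support_coeff_mul_subset f g (Finsupp.mem_support_iff.2 h))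
  rw [Finsupp.mem_support_iff] at h₁ h₂
  have h₁ : w e₁ ≤ r := not_lt.1 fun h => h₁ (hf e₁ h)
  have h₂ : w e₂ ≤ s := not_lt.1 fun h => h₂ (hg e₂ h)
  rw [map_add] at he
  lia

theorem WeightLE.pow (hf : WeightLE w r f) (k : ℕ) : WeightLE w (k * r) (f ^ k) := by
  induction k with
  | zero => exact weightLE_mono (by simp)
  | succ k ih =>
    rw [pow_succ]
    exact (ih.mul hf).mono_right (by push_cast; lia)

/-- The weight `(i, j) ↦ α i + β j`. -/
def weight (α β : ℤ) : ℤ × ℤ →+ ℤ where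
  toFun e := α * e.1 + β * e.2
  map_zero' := by simp
  map_add' e e' := by simp only [Prod.fst_add, Prod.snd_add]; ring

theorem weight_apply (α β i j : ℤ) : weight α β (i, j) = α * i + β * j := rfl

/-- The expansion of `z` in the cluster with variables `mono u` and `mono v`. -/
def loop (u v : ℤ × ℤ) : Laurent := mono (u - v) + mono (v - u) + mono (-(u + v))

/-- The expansions of the cluster variables following the initial cluster
`(mono u, mono v)`. -/
def var (u v : ℤ × ℤ) : ℕ → Laurent
  | 0 => mono u
  | 1 => mono v
  | k + 2 => loop u v * var u v (k + 1) - var u v k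

theorem mono_sub_mul_mono_sub (u v : ℤ × ℤ) : mono (u - v) * mono (v - u) = 1 := by
  rw [mono_mul_mono, ← mono_zero]
  congr 1
  abel

theorem weightLE_var {u v : ℤ × ℤ} {N : ℕ} (hN : 1 ≤ N) (hu : w u = 2 * N - 1)
    (hv : w v = 2 * N - 3) (k : ℕ) :
    WeightLE w (max (2 * N - 3 - 2 * k) (2 * k - 1 - 2 * N)) (var u v (k + 1)) := by
  have ht : WeightLE w 2 (mono (u - v)) := weightLE_mono (by rw [map_sub]; lia)
  have ht' : WeightLE w (-2) (mono (v - u)) := weightLE_mono (by rw [map_sub]; lia)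
  have hε : WeightLE w (4 - 4 * N) (mono (-(u + v))) :=
    weightLE_mono (by rw [map_neg, map_add]; lia)
  suffices h : WeightLE w (2 * k - 1 - 2 * N) (var u v (k + 1) - mono (v - u) * var u v k) ∧
      WeightLE w (max (2 * N - 3 - 2 * k) (2 * k - 1 - 2 * N)) (var u v (k + 1)) from h.2
  induction k with
  | zero =>
    constructor
    · simpa [var, mono_mul_mono] using weightLE_zero
    · exact weightLE_mono (by lia)
  | succ k ih =>
    obtain ⟨ihV, ihX⟩ := ih
    have hV : WeightLE w (2 * (k + 1 : ℕ) - 1 - 2 * N)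
        (var u v (k + 2) - mono (v - u) * var u v (k + 1)) := by
      have h : var u v (k + 2) - mono (v - u) * var u v (k + 1) =
          mono (u - v) * (var u v (k + 1) - mono (v - u) * var u v k) +
            mono (-(u + v)) * var u v (k + 1) := by
        rw [var, loop]
        linear_combination (var u v k) * mono_sub_mul_mono_sub u v
      rw [h]
      exact ((ht.mul ihV).mono_right (by push_cast; lia)).add
        ((hε.mul ihX).mono_right (by push_cast; lia))
    refine ⟨hV, ?_⟩
    have h := (hV.mono_right (le_max_right (2 * N - 3 - 2 * (k + 1 : ℕ) : ℤ) _)).add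
      ((ht'.mul ihX).mono_right (s := max (2 * N - 3 - 2 * (k + 1 : ℕ) : ℤ)
        (2 * (k + 1 : ℕ) - 1 - 2 * N)) (by push_cast; lia))
    rwa [sub_add_cancel] at h

/-- The expansion of `F_m(z)` in every cluster. -/
def cheb : ℕ → Laurent
  | 0 => 2
  | 1 => loop (1, 0) (0, 1)
  | m + 2 => loop (1, 0) (0, 1) * cheb (m + 1) - cheb m

theorem loop_eq : loop (1, 0) (0, 1) = mono (1, -1) + mono (-1, 1) + mono (-1, -1) := rfl

theorem weightLE_cheb_sub (m : ℕ) :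
    WeightLE (weight 1 1) (-1) (cheb m - (mono (m, -m) + mono (-m, m))) := by
  induction m using Nat.twoStepInduction with
  | zero =>
    have h : cheb 0 - (mono ((0 : ℕ), -(0 : ℕ)) + mono (-(0 : ℕ), (0 : ℕ))) = 0 := by
      have h0 : mono ((0 : ℕ), -(0 : ℕ)) = 1 := rfl
      have h1 : mono (-(0 : ℕ), (0 : ℕ)) = 1 := rfl
      rw [h0, h1, cheb]
      norm_num
    rw [h]
    exact weightLE_zero
  | one =>
    have h : cheb 1 - (mono ((1 : ℕ), -(1 : ℕ)) + mono (-(1 : ℕ), (1 : ℕ))) = mono (-1, -1) := by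
      rw [cheb, loop_eq]
      push_cast
      ring
    rw [h]
    exact weightLE_mono (by simp [weight_apply])
  | more m ih₀ ih₁ =>
    have hloop : WeightLE (weight 1 1) 0 (loop (1, 0) (0, 1)) := by
      rw [loop_eq]
      exact ((weightLE_mono (by simp [weight_apply])).add
        (weightLE_mono (by simp [weight_apply]))).add (weightLE_mono (by simp [weight_apply]))
    have htail : WeightLE (weight 1 1) (-1)
        (mono (-1, -1) * (mono ((m + 1 : ℕ), -(m + 1 : ℕ)) + mono (-(m + 1 : ℕ), (m + 1 : ℕ)))) := by
      rw [mul_add, mono_mul_mono, mono_mul_mono]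
      exact (weightLE_mono (by simp only [Prod.mk_add_mk, weight_apply]; lia)).add
        (weightLE_mono (by simp only [Prod.mk_add_mk, weight_apply]; lia))
    have h := (((hloop.mul ih₁).mono_right (by lia)).sub ih₀).add htail
    convert h using 1
    have h₁ : mono ((m + 2 : ℕ), -(m + 2 : ℕ)) =
        mono (1, -1) * mono ((m + 1 : ℕ), -(m + 1 : ℕ)) := by
      rw [mono_mul_mono]
      congr 1
      ext <;> push_cast <;> simp <;> ring
    have h₂ : mono (-(m + 2 : ℕ), (m + 2 : ℕ)) =
        mono (-1, 1) * mono (-(m + 1 : ℕ), (m + 1 : ℕ)) := by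
      rw [mono_mul_mono]
      congr 1
      ext <;> push_cast <;> simp <;> ring
    have h₃ : mono (m, -m) = mono (-1, 1) * mono ((m + 1 : ℕ), -(m + 1 : ℕ)) := by
      rw [mono_mul_mono]
      congr 1
      ext <;> push_cast <;> simp
    have h₄ : mono (-m, m) = mono (1, -1) * mono (-(m + 1 : ℕ), (m + 1 : ℕ)) := by
      rw [mono_mul_mono]
      congr 1
      ext <;> push_cast <;> simp
    rw [h₁, h₂, h₃, h₄, cheb, loop_eq]
    ring

theorem coeff_cheb {e : ℤ × ℤ} (he : 0 ≤ e.1 + e.2) (m : ℕ) :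
    (cheb m).coeff e =
      (if ((m : ℤ), -(m : ℤ)) = e then 1 else 0) + (if (-(m : ℤ), (m : ℤ)) = e then 1 else 0) := by
  have h := weightLE_cheb_sub m e (by change _ < 1 * e.1 + 1 * e.2; lia)
  rwa [AddMonoidAlgebra.coeff_sub, Finsupp.sub_apply, AddMonoidAlgebra.coeff_add,
    Finsupp.add_apply, coeff_mono, coeff_mono, sub_eq_zero] at h

end Laurent

/-! ### Expansion in a cluster -/

/-- Evaluation of Laurent polynomials at the cluster `(x_n, x_{n+1})`. -/
def clusterEval (n : ℤ) : Laurent →+* K :=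
  (AddMonoidAlgebra.lift ℤ K (ℤ × ℤ)
    { toFun := fun e => xK n ^ e.toAdd.1 * xK (n + 1) ^ e.toAdd.2
      map_one' := by simp
      map_mul' := fun e e' => by
        simp only [toAdd_mul, Prod.fst_add, Prod.snd_add, zpow_add₀ (xK_ne_zero _)]
        ring }).toRingHom

theorem clusterEval_single (n i j c : ℤ) :
    clusterEval n (AddMonoidAlgebra.single (i, j) c) = c * (xK n ^ i * xK (n + 1) ^ j) := by
  simp [clusterEval, Algebra.smul_def]

theorem clusterEval_mono (n i j : ℤ) :
    clusterEval n (Laurent.mono (i, j)) = xK n ^ i * xK (n + 1) ^ j := by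
  simp [Laurent.mono, clusterEval_single]

theorem exists_mul_mono_eq_eval₂ (f : Laurent) :
    ∃ (k : ℕ) (P : MvPolynomial (Fin 2) ℤ),
      f * Laurent.mono (k, k) =
        MvPolynomial.eval₂ (Int.castRingHom Laurent)
          ![Laurent.mono (1, 0), Laurent.mono (0, 1)] P := by
  induction f using AddMonoidAlgebra.induction_linear with
  | zero => exact ⟨0, 0, by simp⟩
  | add f g hf hg =>
    obtain ⟨k, P, hP⟩ := hf
    obtain ⟨l, Q, hQ⟩ := hg
    have hsplit : Laurent.mono ((k + l : ℕ), (k + l : ℕ)) =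
        Laurent.mono (k, k) * Laurent.mono (l, l) := by
      rw [Laurent.mono_mul_mono]
      simp
    have hX (k : ℕ) : Laurent.mono (k, k) =
        MvPolynomial.eval₂ (Int.castRingHom Laurent)
          ![Laurent.mono (1, 0), Laurent.mono (0, 1)]
          (MvPolynomial.X 0 ^ k * MvPolynomial.X 1 ^ k) := by
      simp [Laurent.mono_pow, Laurent.mono_mul_mono]
    refine ⟨k + l, P * (MvPolynomial.X 0 ^ l * MvPolynomial.X 1 ^ l) +
      Q * (MvPolynomial.X 0 ^ k * MvPolynomial.X 1 ^ k), ?_⟩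
    rw [MvPolynomial.eval₂_add, MvPolynomial.eval₂_mul, MvPolynomial.eval₂_mul (p := Q),
      ← hX, ← hX, ← hP, ← hQ, hsplit]
    ring
  | single e c =>
    obtain ⟨i, j⟩ := e
    have hconst : AddMonoidAlgebra.single (i, j) c =
        (Int.castRingHom Laurent c) * Laurent.mono (i, j) := by
      rw [eq_intCast, ← zsmul_eq_mul, Laurent.mono, AddMonoidAlgebra.smul_single, smul_eq_mul,
        mul_one]
    refine ⟨i.natAbs + j.natAbs, MvPolynomial.C c *
      (MvPolynomial.X 0 ^ (i + (i.natAbs + j.natAbs : ℕ)).toNat *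
        MvPolynomial.X 1 ^ (j + (i.natAbs + j.natAbs : ℕ)).toNat), ?_⟩
    rw [hconst, mul_assoc, Laurent.mono_mul_mono, MvPolynomial.eval₂_mul, MvPolynomial.eval₂_C,
      MvPolynomial.eval₂_mul, MvPolynomial.eval₂_pow, MvPolynomial.eval₂_pow,
      MvPolynomial.eval₂_X, MvPolynomial.eval₂_X]
    simp only [Matrix.cons_val_zero, Matrix.cons_val_one, Laurent.mono_pow,
      Laurent.mono_mul_mono]
    congr 2
    have := neg_abs_le i
    have := neg_abs_le j
    have := abs_nonneg i
    have := abs_nonneg j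
    ext <;> simp <;> lia

theorem clusterEval_injective (n : ℤ) : Function.Injective (clusterEval n) := by
  rw [injective_iff_map_eq_zero]
  intro f hf
  obtain ⟨k, P, hP⟩ := exists_mul_mono_eq_eval₂ f
  have hP0 : P = 0 := by
    apply MvPolynomial.map_injective _ (Int.castRingHom ℚ).injective_int
    rw [map_zero]
    refine (algebraicIndependent_xK n).eq_zero_of_aeval_eq_zero _ ?_
    have h := congrArg (clusterEval n) hP
    rw [map_mul, hf, zero_mul, MvPolynomial.eval₂_comp_left] at h
    rw [MvPolynomial.aeval_def, MvPolynomial.eval₂_map, h]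
    congr 1
    · exact RingHom.ext_int _ _
    · ext i
      fin_cases i <;> simp [clusterEval_mono]
  rw [hP0, MvPolynomial.eval₂_zero] at hP
  have h := congrArg (· * Laurent.mono (-k, -k)) hP
  simpa [mul_assoc, Laurent.mono_mul_mono, ← Prod.zero_eq_mk, Laurent.mono_zero] using h

theorem coeff_eval₂_nonneg (P : MvPolynomial (Fin 2) ℕ) (e : ℤ × ℤ) :
    0 ≤ (MvPolynomial.eval₂ (Nat.castRingHom Laurent)
      ![Laurent.mono (1, 0), Laurent.mono (0, 1)] P).coeff e := by
  induction P using MvPolynomial.induction_on generalizing e with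
  | C c =>
    rw [MvPolynomial.eval₂_C, eq_natCast, AddMonoidAlgebra.coeff_natCast, Finsupp.single_apply]
    split_ifs <;> simp
  | add P Q hP hQ => simpa using add_nonneg (hP e) (hQ e)
  | mul_X P i hP =>
    rw [MvPolynomial.eval₂_mul, MvPolynomial.eval₂_X]
    fin_cases i <;> simpa [Laurent.mono] using hP _

theorem coeff_nonneg_of_isNonnegLaurent {n : ℤ} {f : Laurent}
    (h : IsNonnegLaurent (xK n) (xK (n + 1)) (clusterEval n f)) (e : ℤ × ℤ) :
    0 ≤ f.coeff e := by
  obtain ⟨k, l, P, hP⟩ := h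
  have hf : f * Laurent.mono (k, l) = MvPolynomial.eval₂ (Nat.castRingHom Laurent)
      ![Laurent.mono (1, 0), Laurent.mono (0, 1)] P := by
    apply clusterEval_injective n
    rw [map_mul, clusterEval_mono, zpow_natCast, zpow_natCast, ← mul_assoc, hP,
      MvPolynomial.eval₂_comp_left]
    congr 1
    · exact RingHom.ext fun _ => by simp
    · ext i
      fin_cases i <;> simp [clusterEval_mono]
  have h := coeff_eval₂_nonneg P (e + ((k : ℤ), (l : ℤ)))
  rw [← hf, Laurent.mono, AddMonoidAlgebra.coeff_mul_single_apply,
    add_neg_cancel_right, mul_one] at h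
  exact h

theorem clusterEval_loop (n : ℤ) : clusterEval n (Laurent.loop (1, 0) (0, 1)) = zK := by
  have h := zK_mul_xK_mul_xK n
  have h0 := xK_ne_zero n
  have h1 := xK_ne_zero (n + 1)
  rw [Laurent.loop_eq, map_add, map_add, clusterEval_mono, clusterEval_mono, clusterEval_mono]
  simp only [zpow_neg, zpow_one]
  field_simp
  linear_combination -h

theorem clusterEval_cheb (n : ℤ) (m : ℕ) :
    clusterEval n (Laurent.cheb m) = Polynomial.aeval zK (chebF m) := by
  induction m using Nat.twoStepInduction with
  | zero =>
    rw [Laurent.cheb, chebF, map_ofNat, map_ofNat]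
  | one => rw [Laurent.cheb, chebF, clusterEval_loop, Polynomial.aeval_X]
  | more m ih₀ ih₁ =>
    rw [Laurent.cheb, chebF, map_sub, map_mul, clusterEval_loop, ih₀, ih₁, map_sub, map_mul,
      Polynomial.aeval_X]

theorem clusterEval_var (n : ℤ) (k : ℕ) :
    clusterEval n (Laurent.var (1, 0) (0, 1) k) = xK (n + k) := by
  induction k using Nat.twoStepInduction with
  | zero => simp [Laurent.var, clusterEval_mono]
  | one => simp [Laurent.var, clusterEval_mono]
  | more k ih₀ ih₁ =>
    rw [Laurent.var, map_sub, map_mul, clusterEval_loop, ih₀, ih₁, zK_mul_xK]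
    push_cast
    ring_nf

theorem clusterEval_var_swap (n : ℤ) (k : ℕ) :
    clusterEval n (Laurent.var (0, 1) (1, 0) k) = xK (n + 1 - k) := by
  have hloop : Laurent.loop (0, 1) (1, 0) = Laurent.loop (1, 0) (0, 1) := by
    rw [Laurent.loop, Laurent.loop, add_comm (Laurent.mono _), add_comm ((0, 1) : ℤ × ℤ)]
  induction k using Nat.twoStepInduction with
  | zero => simp [Laurent.var, clusterEval_mono]
  | one => simp [Laurent.var, clusterEval_mono]
  | more k ih₀ ih₁ =>
    rw [Laurent.var, map_sub, map_mul, hloop, clusterEval_loop, ih₀, ih₁, zK_mul_xK]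
    push_cast
    ring_nf

/-! ### Extracting the coefficients of the atoms -/

open Laurent in
/-- A cluster monomial to the right of a cluster has an expansion of
negative weight. -/
theorem exists_weightLE_expansion_right (n : ℤ) {N : ℕ} (hN : 1 ≤ N) (p q : ℕ) :
    ∃ f, clusterEval n f = atom (.inl (n + N, p, q)) ∧
      WeightLE (weight (2 * N - 1) (2 * N - 3)) (-1) f := by
  obtain ⟨k, rfl⟩ := Nat.exists_eq_add_of_le' hN
  have hu : weight (2 * (k + 1 : ℕ) - 1) (2 * (k + 1 : ℕ) - 3) (1, 0) =
      2 * (k + 1 : ℕ) - 1 := by simp [weight_apply]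
  have hv : weight (2 * (k + 1 : ℕ) - 1) (2 * (k + 1 : ℕ) - 3) (0, 1) =
      2 * (k + 1 : ℕ) - 3 := by simp [weight_apply]
  have h₁ := (weightLE_var hN hu hv k).mono_right (s := -1) (by push_cast; lia)
  have h₂ := (weightLE_var hN hu hv (k + 1)).mono_right (s := -1) (by push_cast; lia)
  refine ⟨_, ?_, ((h₁.pow (p + 1)).mul (h₂.pow q)).mono_right (by push_cast; lia)⟩
  rw [map_mul, map_pow, map_pow, clusterEval_var, clusterEval_var, atom]
  push_cast
  ring_nf

open Laurent in
theorem exists_weightLE_expansion_left (n : ℤ) {N : ℕ} (hN : 1 ≤ N) (p q : ℕ) :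
    ∃ f, clusterEval n f = atom (.inl (n - N, p, q)) ∧
      WeightLE (weight (2 * N - 3) (2 * N - 1)) (-1) f := by
  obtain ⟨k, rfl⟩ := Nat.exists_eq_add_of_le' hN
  have hu : weight (2 * (k + 1 : ℕ) - 3) (2 * (k + 1 : ℕ) - 1) (0, 1) =
      2 * (k + 1 : ℕ) - 1 := by simp [weight_apply]
  have hv : weight (2 * (k + 1 : ℕ) - 3) (2 * (k + 1 : ℕ) - 1) (1, 0) =
      2 * (k + 1 : ℕ) - 3 := by simp [weight_apply]
  have h₁ := (weightLE_var hN hu hv k).mono_right (s := -1) (by push_cast; lia)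
  have h₂ := (weightLE_var hN hu hv (k + 1)).mono_right (s := -1) (by push_cast; lia)
  refine ⟨_, ?_, ((h₂.pow (p + 1)).mul (h₁.pow q)).mono_right (by push_cast; lia)⟩
  rw [map_mul, map_pow, map_pow, clusterEval_var_swap, clusterEval_var_swap, atom]
  push_cast
  ring_nf

open Laurent in
theorem exists_expansion_coeff_loop (n : ℤ) (M : ℕ) {i : (ℤ × ℕ × ℕ) ⊕ ℕ}
    (hi : ∀ t, i = .inl t → n + 2 ≤ t.1) :
    ∃ f, clusterEval n f = atom i ∧ f.coeff (M, -M) = if i = .inr M then 1 else 0 := by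
  rcases i with ⟨k, p, q⟩ | _ | m
  · have hk : n + 2 ≤ k := hi _ rfl
    obtain ⟨N, rfl⟩ : ∃ N : ℕ, k = n + N := ⟨(k - n).toNat, by lia⟩
    obtain ⟨f, hf, hw⟩ := exists_weightLE_expansion_right n (N := N) (by lia) p q
    refine ⟨f, hf, ?_⟩
    rw [hw _ (by rw [weight_apply]; lia), if_neg (by simp)]
  · refine ⟨1, map_one _, ?_⟩
    rw [← mono_zero, coeff_mono]
    congr 1
    simp [Prod.ext_iff, eq_comm]
  · refine ⟨cheb (m + 1), clusterEval_cheb n (m + 1), ?_⟩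
    rw [coeff_cheb (by simp), if_neg (c := (-((m + 1 : ℕ) : ℤ), ((m + 1 : ℕ) : ℤ)) = _)
      (by simp only [Prod.ext_iff]; lia), add_zero]
    congr 1
    simp only [Prod.ext_iff, Sum.inr.injEq, eq_iff_iff]
    lia

open Laurent in
theorem exists_expansion_coeff_monomial (n : ℤ) (P Q : ℕ) (i : (ℤ × ℕ × ℕ) ⊕ ℕ) :
    ∃ f, clusterEval n f = atom i ∧
      f.coeff ((P + 1 : ℕ), Q) = if i = .inl (n, P, Q) then 1 else 0 := by
  rcases i with ⟨k, p, q⟩ | _ | m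
  · rcases lt_trichotomy k n with hk | rfl | hk
    · rw [if_neg (by simp; lia)]
      obtain ⟨N, rfl⟩ : ∃ N : ℕ, k = n - N := ⟨(n - k).toNat, by lia⟩
      obtain rfl | hN : N = 1 ∨ 2 ≤ N := by lia
      · have h : WeightLE (weight 0 1) (-1) (var (0, 1) (1, 0) 2) := by
          have h2 : var (0, 1) (1, 0) 2 = mono (2, -1) + mono (0, -1) := by
            simp only [var, loop, add_mul, mono_mul_mono]
            simp
            ring
          rw [h2]
          exact (weightLE_mono (by simp [weight_apply])).add
            (weightLE_mono (by simp [weight_apply]))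
        have h' : WeightLE (weight 0 1) 0 (mono (1, 0)) := weightLE_mono (by simp [weight_apply])
        refine ⟨var (0, 1) (1, 0) 2 ^ (p + 1) * mono (1, 0) ^ q, ?_, ?_⟩
        · rw [map_mul, map_pow, map_pow, clusterEval_var_swap, clusterEval_mono, atom]
          simp only [zpow_one, zpow_zero, mul_one]
          push_cast
          ring_nf
        · exact ((h.pow (p + 1)).mul (h'.pow q)) _ (by rw [weight_apply]; push_cast; lia)
      · obtain ⟨f, hf, hw⟩ := exists_weightLE_expansion_left n (N := N) (by lia) p q
        refine ⟨f, hf, hw _ ?_⟩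
        rw [weight_apply]
        have h1 : (0 : ℤ) ≤ (2 * N - 3) * (P + 1 : ℕ) := mul_nonneg (by lia) (by lia)
        have h2 : (0 : ℤ) ≤ (2 * N - 1) * Q := mul_nonneg (by lia) (by lia)
        lia
    · refine ⟨mono ((p + 1 : ℕ), q), ?_, ?_⟩
      · rw [clusterEval_mono, zpow_natCast, zpow_natCast, atom]
      · rw [coeff_mono]
        congr 1
        simp
    · rw [if_neg (by simp; lia)]
      obtain ⟨N, rfl⟩ : ∃ N : ℕ, k = n + N := ⟨(k - n).toNat, by lia⟩
      obtain rfl | hN : N = 1 ∨ 2 ≤ N := by lia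
      · have h : WeightLE (weight 1 0) (-1) (var (1, 0) (0, 1) 2) := by
          have h2 : var (1, 0) (0, 1) 2 = mono (-1, 2) + mono (-1, 0) := by
            simp only [var, loop, add_mul, mono_mul_mono]
            simp
            ring
          rw [h2]
          exact (weightLE_mono (by simp [weight_apply])).add
            (weightLE_mono (by simp [weight_apply]))
        have h' : WeightLE (weight 1 0) 0 (mono (0, 1)) := weightLE_mono (by simp [weight_apply])
        refine ⟨mono (0, 1) ^ (p + 1) * var (1, 0) (0, 1) 2 ^ q, ?_, ?_⟩
        · rw [map_mul, map_pow, map_pow, clusterEval_var, clusterEval_mono, atom]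
          simp only [zpow_one, zpow_zero, one_mul]
          push_cast
          ring_nf
        · exact ((h'.pow (p + 1)).mul (h.pow q)) _ (by rw [weight_apply]; push_cast; lia)
      · obtain ⟨f, hf, hw⟩ := exists_weightLE_expansion_right n (N := N) (by lia) p q
        refine ⟨f, hf, hw _ ?_⟩
        rw [weight_apply]
        have h1 : (0 : ℤ) ≤ (2 * N - 1) * (P + 1 : ℕ) := mul_nonneg (by lia) (by lia)
        have h2 : (0 : ℤ) ≤ (2 * N - 3) * Q := mul_nonneg (by lia) (by lia)
        lia
  · refine ⟨1, map_one _, ?_⟩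
    rw [← mono_zero, coeff_mono, if_neg (by simp [Prod.ext_iff]; lia), if_neg (by simp)]
  · refine ⟨cheb (m + 1), clusterEval_cheb n (m + 1), ?_⟩
    rw [coeff_cheb (by simp; lia), if_neg (by simp only [Prod.ext_iff]; lia),
      if_neg (by simp only [Prod.ext_iff]; lia), if_neg (by simp), add_zero]

/-- If a monomial detects the atom `i₀` among the atoms of a combination that is a nonnegative
Laurent polynomial in some cluster, then the coefficient of `i₀` is nonnegative. -/
theorem coeff_atom_nonneg {n : ℤ} {c : (ℤ × ℕ × ℕ) ⊕ ℕ →₀ ℤ} (e : ℤ × ℤ)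
    {i₀ : (ℤ × ℕ × ℕ) ⊕ ℕ}
    (hexp : ∀ i ∈ c.support, ∃ f, clusterEval n f = atom i ∧
      f.coeff e = if i = i₀ then 1 else 0)
    (hpos : IsNonnegLaurent (xK n) (xK (n + 1)) (c.sum fun i k => k • atom i)) :
    0 ≤ c i₀ := by
  choose! f hf hcoeff using hexp
  have hsum : clusterEval n (∑ i ∈ c.support, c i • f i) = c.sum fun i k => k • atom i := by
    rw [map_sum, Finsupp.sum]
    exact Finset.sum_congr rfl fun i hi => by rw [map_zsmul, hf i hi]
  rw [← hsum] at hpos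
  have h := coeff_nonneg_of_isNonnegLaurent hpos e
  rw [AddMonoidAlgebra.coeff_sum, Finsupp.finsetSum_apply, Finset.sum_congr rfl
    (g := fun i => if i = i₀ then c i else 0) fun i hi => by
      rw [AddMonoidAlgebra.coeff_smul_apply, hcoeff i hi]; simp] at h
  rw [Finset.sum_ite_eq'] at h
  split_ifs at h with h0
  · exact h
  · rw [Finsupp.notMem_support_iff.1 h0]

/-- Property (B3) in type `Ã_{1,1}`: if `y` belongs to the cluster algebra `A`
(the subring of `K` generated by the cluster variables) and `y` is a nonnegative
Laurent polynomial in every cluster `(x_n, x_{n+1})`, then `y` is a finite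
`ℕ`-linear combination of elements of `B`. -/
theorem positive_elements_are_nonneg_combinations (y : K)
    (hy : y ∈ Subring.closure (Set.range xK))
    (hpos : ∀ n : ℤ, IsNonnegLaurent (xK n) (xK (n + 1)) y) :
    ∃ c : K →₀ ℕ, ↑c.support ⊆ atomicSet ∧ y = c.sum fun e k => (k : K) * e := by
  obtain ⟨c, rfl⟩ := Finsupp.mem_span_range_iff_exists_finsupp.1
    (closure_range_xK_subset_atomSpan hy)
  have hc (i : (ℤ × ℕ × ℕ) ⊕ ℕ) : 0 ≤ c i := by
    rcases i with ⟨n, p, q⟩ | m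
    · exact coeff_atom_nonneg _ (fun i _ => exists_expansion_coeff_monomial n p q i) (hpos n)
    · obtain ⟨n, hn⟩ : ∃ n : ℤ, ∀ i ∈ c.support, ∀ t, i = .inl t → n ≤ t.1 := by
        obtain ⟨n, hn⟩ := (c.support.image (Sum.elim Prod.fst fun _ => 0)).bddBelow
        exact ⟨n, fun i hi t ht => hn (Finset.mem_image.2 ⟨i, hi, by rw [ht]; rfl⟩)⟩
      refine coeff_atom_nonneg _ (fun i hi => exists_expansion_coeff_loop (n - 2) m ?_)
        (hpos (n - 2))
      intro t ht
      linarith [hn i hi t ht]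
  have hmem : (c.sum fun i k => k • atom i) ∈ Submodule.span ℕ atomicSet := by
    refine sum_mem fun i _ => ?_
    change c i • atom i ∈ _
    rw [← Int.toNat_of_nonneg (hc i), natCast_zsmul]
    exact Submodule.smul_mem _ _ (Submodule.subset_span (atom_mem_atomicSet i))
  obtain ⟨d, hd, hsum⟩ := Submodule.mem_span_set.1 hmem
  exact ⟨d, hd, by simp only [← hsum, nsmul_eq_mul]⟩
end
end

section
/- For all i, j ∈ ℤ/5ℤ, the cluster variable c_j is a nonnegative Laurent polynomial in (c_i, c_{i+1}); consequently every cluster monomial c_j^p·c_{j+1}^q (p, q ∈ ℕ) is a nonnegative Laurent polynomial in every cluster (c_i, c_{i+1}). (This is positivity property (A2) of the type A theorem, in the case n = 2.) -/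
noncomputable section

/-- The five cluster variables of the coefficient-free cluster algebra of type
`A_2`, indexed by `ℤ/5ℤ`: `c_1 = a`, `c_2 = b`, `c_3 = (1+b)/a`,
`c_4 = (1+a+b)/(a·b)`, `c_5 = c_0 = (1+a)/b`. -/
def cA (i : ZMod 5) : K :=
  if i = 1 then a
  else if i = 2 then b
  else if i = 3 then (1 + b) / a
  else if i = 4 then (1 + a + b) / (a * b)
  else (1 + a) / b

theorem cA_zero : cA 0 = (1 + a) / b := rfl

theorem cA_one : cA 1 = a := rfl

theorem cA_two : cA 2 = b := rfl

theorem cA_three : cA 3 = (1 + b) / a := rfl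

theorem cA_four : cA 4 = (1 + a + b) / (a * b) := rfl

/-- The exchange relation `c_i * c_{i+2} = 1 + c_{i+1}`. -/
theorem cA_mul_cA_add_two (i : ZMod 5) : cA i * cA (i + 2) = 1 + cA (i + 1) := by
  have ha := a_ne_zero
  have hb := b_ne_zero
  have h : i = 0 ∨ i = 1 ∨ i = 2 ∨ i = 3 ∨ i = 4 := by revert i; decide
  rcases h with rfl | rfl | rfl | rfl | rfl
  · change cA 0 * cA 2 = 1 + cA 1
    rw [cA_zero, cA_one, cA_two]
    field_simp
  · change cA 1 * cA 3 = 1 + cA 2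
    rw [cA_one, cA_two, cA_three]
    field_simp
  · change cA 2 * cA 4 = 1 + cA 3
    rw [cA_two, cA_three, cA_four]
    field_simp
    ring
  · change cA 3 * cA 0 = 1 + cA 4
    rw [cA_zero, cA_three, cA_four]
    field_simp
    ring
  · change cA 4 * cA 1 = 1 + cA 0
    rw [cA_zero, cA_one, cA_four]
    field_simp
    ring

namespace IsNonnegLaurent

variable {u v y z : K}

theorem one : IsNonnegLaurent u v 1 := ⟨0, 0, 1, by simp⟩

theorem mul (hy : IsNonnegLaurent u v y) (hz : IsNonnegLaurent u v z) :
    IsNonnegLaurent u v (y * z) := by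
  obtain ⟨k, l, P, hP⟩ := hy
  obtain ⟨k', l', Q, hQ⟩ := hz
  refine ⟨k + k', l + l', P * Q, ?_⟩
  rw [MvPolynomial.eval₂_mul, ← hP, ← hQ]
  ring

theorem pow (hy : IsNonnegLaurent u v y) (n : ℕ) : IsNonnegLaurent u v (y ^ n) := by
  induction n with
  | zero => simpa using one
  | succ n ih => simpa only [pow_succ] using ih.mul hy

end IsNonnegLaurent

/-- Each cluster variable is a nonnegative Laurent polynomial in each cluster. -/
theorem isNonnegLaurent_cA (i j : ZMod 5) : IsNonnegLaurent (cA i) (cA (i + 1)) (cA j) := by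
  have h02 := cA_mul_cA_add_two i
  have h13 : cA (i + 1) * cA (i + 3) = 1 + cA (i + 2) := by
    convert cA_mul_cA_add_two (i + 1) using 3 <;> ring
  have h41 : cA (i + 4) * cA (i + 1) = 1 + cA i := by
    have h5 : (5 : ZMod 5) = 0 := rfl
    convert cA_mul_cA_add_two (i + 4) using 3 <;> linear_combination -h5
  have h : j = i ∨ j = i + 1 ∨ j = i + 2 ∨ j = i + 3 ∨ j = i + 4 := by
    clear h02 h13 h41; revert i j; decide
  rcases h with rfl | rfl | rfl | rfl | rfl
  · exact ⟨0, 0, MvPolynomial.X 0, by simp⟩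
  · exact ⟨0, 0, MvPolynomial.X 1, by simp⟩
  · refine ⟨1, 0, 1 + MvPolynomial.X 1, ?_⟩
    simp only [MvPolynomial.eval₂_add, MvPolynomial.eval₂_one, MvPolynomial.eval₂_X,
      Matrix.cons_val_one, Matrix.cons_val_fin_one]
    linear_combination h02
  · refine ⟨1, 1, 1 + MvPolynomial.X 0 + MvPolynomial.X 1, ?_⟩
    simp only [MvPolynomial.eval₂_add, MvPolynomial.eval₂_one, MvPolynomial.eval₂_X,
      Matrix.cons_val_zero, Matrix.cons_val_one, Matrix.cons_val_fin_one]
    linear_combination cA i * h13 + h02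
  · refine ⟨0, 1, 1 + MvPolynomial.X 0, ?_⟩
    simp only [MvPolynomial.eval₂_add, MvPolynomial.eval₂_one, MvPolynomial.eval₂_X,
      Matrix.cons_val_zero]
    linear_combination h41

/-- Positivity (A2) in type `A_2`: for all `i, j ∈ ℤ/5ℤ`, the cluster variable
`c_j` is a nonnegative Laurent polynomial in the cluster `(c_i, c_{i+1})`;
consequently every cluster monomial `c_j^p·c_{j+1}^q` is a nonnegative Laurent
polynomial in every cluster. -/
theorem typeA_cluster_monomials_positive :
    (∀ i j : ZMod 5, IsNonnegLaurent (cA i) (cA (i + 1)) (cA j)) ∧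
    (∀ i j : ZMod 5, ∀ p q : ℕ,
      IsNonnegLaurent (cA i) (cA (i + 1)) (cA j ^ p * cA (j + 1) ^ q)) :=
  ⟨isNonnegLaurent_cA, fun i j p q =>
    ((isNonnegLaurent_cA i j).pow p).mul ((isNonnegLaurent_cA i (j + 1)).pow q)⟩
end
end

section
/- Let A be the subring of K generated by c_1, c_2, c_3, c_4, c_5 (the coefficient-free cluster algebra of type A_2). Then the set of cluster monomials {c_i^p·c_{i+1}^q : i ∈ ℤ/5ℤ, p, q ∈ ℕ} is a ℤ-linear basis of A: it is ℤ-linearly independent and its ℤ-span equals A. (This is property (A1) of the type A theorem, in the case n = 2.) -/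
noncomputable section

/-- The set of cluster monomials of the type `A_2` cluster algebra. -/
def clusterMonomials : Set K :=
  {y | ∃ (i : ZMod 5) (p q : ℕ), y = cA i ^ p * cA (i + 1) ^ q}

/-- Hahn series that are nonzero and have pairwise distinct orders are linearly independent
over `ℤ`. -/
theorem HahnSeries.linearIndependent_int_of_injective_order {ι Γ R : Type*} [Zero Γ]
    [LinearOrder Γ] [Ring R] [NoZeroDivisors R] [CharZero R] {x : ι → HahnSeries Γ R}
    (hne : ∀ i, x i ≠ 0) (hinj : Function.Injective fun i => (x i).order) :
    LinearIndependent ℤ x := by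
  rw [linearIndependent_iff]
  intro l hl
  by_contra hl0
  obtain ⟨i, hi, hmin⟩ := l.support.exists_min_image (fun i => (x i).order)
    (Finsupp.support_nonempty_iff.2 hl0)
  have hcoeff := congrArg (fun y => y.coeff (x i).order) hl
  simp only [Finsupp.linearCombination_apply, Finsupp.sum, HahnSeries.coeff_sum,
    HahnSeries.coeff_smul, HahnSeries.coeff_zero] at hcoeff
  rw [Finset.sum_eq_single_of_mem i hi, zsmul_eq_mul, mul_eq_zero, Int.cast_eq_zero,
    HahnSeries.coeff_order_eq_zero] at hcoeff
  · exact hcoeff.elim (Finsupp.mem_support_iff.1 hi) (hne i)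
  · intro j hj hji
    rw [HahnSeries.coeff_eq_zero_of_lt_order, smul_zero]
    exact lt_of_le_of_ne (hmin j hj) fun h => hji (hinj h.symm)

/-- The field of Hahn series in two variables with lexicographically ordered exponents. -/
abbrev LexHahnSeries : Type := HahnSeries (ℤ ×ₗ ℤ) ℚ

/-- The monomial with coefficient `1` and exponent `(u, v)`. -/
def lexMonomial (u v : ℤ) : LexHahnSeries := HahnSeries.single (toLex (u, v)) 1

/-- The expansion of polynomials in two variables as Hahn series. -/
def polynomialToHahn : MvPolynomial (Fin 2) ℚ →+* LexHahnSeries :=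
  MvPolynomial.eval₂Hom HahnSeries.C ![lexMonomial 1 0, lexMonomial 0 1]

theorem coeff_polynomialToHahn (P : MvPolynomial (Fin 2) ℚ) (d : Fin 2 →₀ ℕ) :
    (polynomialToHahn P).coeff (toLex ((d 0 : ℤ), (d 1 : ℤ))) = P.coeff d := by
  induction P using MvPolynomial.induction_on' with
  | monomial e r =>
    have hmon : polynomialToHahn (MvPolynomial.monomial e r) =
        HahnSeries.single (toLex ((e 0 : ℤ), (e 1 : ℤ))) r := by
      rw [polynomialToHahn, MvPolynomial.coe_eval₂Hom, MvPolynomial.eval₂_monomial,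
        Finsupp.prod_fintype _ _ fun _ => pow_zero _, Fin.prod_univ_two]
      simp only [Matrix.cons_val_zero, Matrix.cons_val_one, lexMonomial, HahnSeries.single_pow,
        HahnSeries.single_mul_single, HahnSeries.C_apply, one_pow, mul_one, zero_add]
      congr 2
      change toLex (e 0 • ((1 : ℤ), (0 : ℤ)) + e 1 • ((0 : ℤ), (1 : ℤ))) = _
      simp
    rw [hmon, MvPolynomial.coeff_monomial]
    split_ifs with h
    · rw [h, HahnSeries.coeff_single_same]
    · refine HahnSeries.coeff_single_of_ne fun h' => h ?_
      simp only [EmbeddingLike.apply_eq_iff_eq, Prod.mk.injEq, Nat.cast_inj] at h'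
      ext i
      fin_cases i
      · exact h'.1.symm
      · exact h'.2.symm
  | add P Q hP hQ => simp [hP, hQ]

theorem polynomialToHahn_injective : Function.Injective polynomialToHahn := by
  rw [injective_iff_map_eq_zero]
  intro P hP
  ext d
  rw [← coeff_polynomialToHahn, hP]
  simp

/-- The expansion of rational functions in `a` and `b` as Hahn series. -/
def toHahn : K →+* LexHahnSeries := IsFractionRing.lift polynomialToHahn_injective

theorem toHahn_a : toHahn a = lexMonomial 1 0 := by
  simp [toHahn, a, IsFractionRing.lift_algebraMap, polynomialToHahn]

theorem toHahn_b : toHahn b = lexMonomial 0 1 := by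
  simp [toHahn, b, IsFractionRing.lift_algebraMap, polynomialToHahn]

/-- The exponent of the lowest term of a rational function in `a` and `b`. -/
def lexOrder (x : K) : ℤ × ℤ := ofLex (toHahn x).order

theorem lexOrder_mul {x y : K} (hx : x ≠ 0) (hy : y ≠ 0) :
    lexOrder (x * y) = lexOrder x + lexOrder y := by
  rw [lexOrder, map_mul, HahnSeries.order_mul (by simpa) (by simpa)]
  rfl

theorem lexOrder_pow (x : K) (n : ℕ) : lexOrder (x ^ n) = n • lexOrder x := by
  rw [lexOrder, map_pow, HahnSeries.order_pow]
  rfl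

theorem lexOrder_div {x y : K} (hx : x ≠ 0) (hy : y ≠ 0) :
    lexOrder (x / y) = lexOrder x - lexOrder y := by
  rw [eq_sub_iff_add_eq, ← lexOrder_mul (div_ne_zero hx hy) hy, div_mul_cancel₀ _ hy]

theorem lexOrder_a : lexOrder a = (1, 0) := by
  simp [lexOrder, toHahn_a, lexMonomial]

theorem lexOrder_b : lexOrder b = (0, 1) := by
  simp [lexOrder, toHahn_b, lexMonomial]

theorem orderTop_one_add {x : LexHahnSeries} (hx : 0 < x.orderTop) : (1 + x).orderTop = 0 := by
  rw [HahnSeries.orderTop_add_eq_left (by simpa using hx), HahnSeries.orderTop_one]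

theorem one_add_ne_zero {x : K} (hx : 0 < (toHahn x).orderTop) : 1 + x ≠ 0 := by
  intro h
  have := orderTop_one_add hx
  rw [← map_one toHahn, ← map_add, h] at this
  simp at this

theorem lexOrder_one_add {x : K} (hx : 0 < (toHahn x).orderTop) : lexOrder (1 + x) = 0 := by
  have hne : toHahn (1 + x) ≠ 0 := (map_ne_zero toHahn).2 (one_add_ne_zero hx)
  have h := HahnSeries.order_eq_orderTop_of_ne_zero hne
  rw [map_add, map_one, orderTop_one_add hx, ← map_one toHahn, ← map_add] at h
  rw [lexOrder, WithTop.coe_eq_zero.1 h]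
  rfl

theorem orderTop_toHahn_a_pos : 0 < (toHahn a).orderTop := by
  rw [toHahn_a, lexMonomial, HahnSeries.orderTop_single one_ne_zero]
  exact WithTop.coe_pos.2 (by decide)

theorem orderTop_toHahn_b_pos : 0 < (toHahn b).orderTop := by
  rw [toHahn_b, lexMonomial, HahnSeries.orderTop_single one_ne_zero]
  exact WithTop.coe_pos.2 (by decide)

theorem orderTop_toHahn_a_add_b_pos : 0 < (toHahn (a + b)).orderTop := by
  rw [map_add]
  exact (lt_min orderTop_toHahn_a_pos orderTop_toHahn_b_pos).trans_le
    HahnSeries.min_orderTop_le_orderTop_add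

theorem one_add_a_ne_zero : 1 + a ≠ 0 := one_add_ne_zero orderTop_toHahn_a_pos

theorem one_add_b_ne_zero : 1 + b ≠ 0 := one_add_ne_zero orderTop_toHahn_b_pos

theorem one_add_a_add_b_ne_zero : 1 + a + b ≠ 0 := by
  rw [add_assoc]
  exact one_add_ne_zero orderTop_toHahn_a_add_b_pos

theorem cA_ne_zero (i : ZMod 5) : cA i ≠ 0 := by
  fin_cases i
  · exact div_ne_zero one_add_a_ne_zero b_ne_zero
  · exact a_ne_zero
  · exact b_ne_zero
  · exact div_ne_zero one_add_b_ne_zero a_ne_zero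
  · exact div_ne_zero one_add_a_add_b_ne_zero (mul_ne_zero a_ne_zero b_ne_zero)

theorem lexOrder_cA_zero : lexOrder (cA 0) = (0, -1) := by
  rw [cA_zero, lexOrder_div one_add_a_ne_zero b_ne_zero,
    lexOrder_one_add orderTop_toHahn_a_pos, lexOrder_b]
  rfl

theorem lexOrder_cA_three : lexOrder (cA 3) = (-1, 0) := by
  rw [cA_three, lexOrder_div one_add_b_ne_zero a_ne_zero,
    lexOrder_one_add orderTop_toHahn_b_pos, lexOrder_a]
  rfl

theorem lexOrder_cA_four : lexOrder (cA 4) = (-1, -1) := by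
  rw [cA_four, lexOrder_div one_add_a_add_b_ne_zero (mul_ne_zero a_ne_zero b_ne_zero),
    lexOrder_mul a_ne_zero b_ne_zero, add_assoc,
    lexOrder_one_add orderTop_toHahn_a_add_b_pos, lexOrder_a, lexOrder_b]
  rfl

/-- The cluster monomial whose lowest term has exponent `d`. -/
def monomialOfOrder (d : ℤ × ℤ) : K :=
  cA 1 ^ d.1.toNat * cA 2 ^ d.2.toNat * cA 4 ^ (min (-d.1) (-d.2)).toNat *
    cA 3 ^ ((-d.1).toNat - (min (-d.1) (-d.2)).toNat) *
    cA 0 ^ ((-d.2).toNat - (min (-d.1) (-d.2)).toNat)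

theorem lexOrder_monomialOfOrder (d : ℤ × ℤ) : lexOrder (monomialOfOrder d) = d := by
  have h (i : ZMod 5) (n : ℕ) : cA i ^ n ≠ 0 := pow_ne_zero n (cA_ne_zero i)
  rw [monomialOfOrder, lexOrder_mul (by simp [cA_ne_zero]) (h _ _),
    lexOrder_mul (by simp [cA_ne_zero]) (h _ _), lexOrder_mul (by simp [cA_ne_zero]) (h _ _),
    lexOrder_mul (h _ _) (h _ _)]
  simp only [lexOrder_pow, cA_one, cA_two, lexOrder_a, lexOrder_b, lexOrder_cA_zero,
    lexOrder_cA_three, lexOrder_cA_four]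
  ext <;> simp <;> omega

theorem exists_eq_monomialOfOrder {x : K} (hx : x ∈ clusterMonomials) :
    ∃ d, x = monomialOfOrder d := by
  obtain ⟨i, p, q, rfl⟩ := hx
  fin_cases i
  · refine ⟨(q, -p), ?_⟩
    change cA 0 ^ p * cA 1 ^ q = _
    simp [monomialOfOrder, mul_comm]
  · refine ⟨(p, q), ?_⟩
    change cA 1 ^ p * cA 2 ^ q = _
    have hmin : (-max (p : ℤ) q).toNat = 0 := by omega
    simp [monomialOfOrder, hmin]
  · refine ⟨(-q, p), ?_⟩
    change cA 2 ^ p * cA 3 ^ q = _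
    simp [monomialOfOrder]
  · refine ⟨(-p - q, -q), ?_⟩
    change cA 3 ^ p * cA 4 ^ q = _
    have hexp : ((q : ℤ) + p).toNat - q = p := by omega
    simp [monomialOfOrder, hexp, mul_comm]
  · refine ⟨(-p, -p - q), ?_⟩
    change cA 4 ^ p * cA 0 ^ q = _
    have hexp : ((q : ℤ) + p).toNat - p = q := by omega
    simp [monomialOfOrder, hexp]

theorem ne_zero_of_mem_clusterMonomials {x : K} (hx : x ∈ clusterMonomials) : x ≠ 0 := by
  obtain ⟨i, p, q, rfl⟩ := hx
  simp [cA_ne_zero]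

theorem lexOrder_injOn_clusterMonomials : Set.InjOn lexOrder clusterMonomials := by
  intro x hx y hy hxy
  obtain ⟨d, rfl⟩ := exists_eq_monomialOfOrder hx
  obtain ⟨e, rfl⟩ := exists_eq_monomialOfOrder hy
  rw [lexOrder_monomialOfOrder, lexOrder_monomialOfOrder] at hxy
  rw [hxy]

theorem linearIndependent_clusterMonomials :
    LinearIndependent ℤ ((↑) : clusterMonomials → K) := by
  refine LinearIndependent.of_comp toHahn.toAddMonoidHom.toIntLinearMap
    (HahnSeries.linearIndependent_int_of_injective_order ?_ ?_)
  · intro x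
    simpa using ne_zero_of_mem_clusterMonomials x.2
  · intro x y hxy
    exact Subtype.ext (lexOrder_injOn_clusterMonomials x.2 y.2 hxy)

theorem monomial_mem_span (i : ZMod 5) (p q : ℕ) :
    cA i ^ p * cA (i + 1) ^ q ∈ Submodule.span ℤ clusterMonomials :=
  Submodule.subset_span ⟨i, p, q, rfl⟩

theorem cA_add_two_mul_monomial_mem_span (i : ZMod 5) (p q : ℕ) :
    cA (i + 2) * (cA i ^ p * cA (i + 1) ^ q) ∈ Submodule.span ℤ clusterMonomials := by
  cases p with
  | zero =>
    convert monomial_mem_span (i + 1) q 1 using 1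
    rw [add_assoc, one_add_one_eq_two]
    ring
  | succ p =>
    convert add_mem (monomial_mem_span i p q) (monomial_mem_span i p (q + 1)) using 1
    linear_combination cA i ^ p * cA (i + 1) ^ q * cA_mul_cA_add_two i

theorem cA_sub_one_mul_monomial_mem_span (i : ZMod 5) (p q : ℕ) :
    cA (i - 1) * (cA i ^ p * cA (i + 1) ^ q) ∈ Submodule.span ℤ clusterMonomials := by
  have hrel := cA_mul_cA_add_two (i - 1)
  rw [sub_add_cancel, show i - 1 + 2 = i + 1 by ring] at hrel
  cases q with
  | zero =>
    convert monomial_mem_span (i - 1) 1 p using 1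
    rw [sub_add_cancel]
    ring
  | succ q =>
    convert add_mem (monomial_mem_span i p q) (monomial_mem_span i (p + 1) q) using 1
    linear_combination cA i ^ p * cA (i + 1) ^ q * hrel

theorem cA_add_three_mul_monomial_mem_span (i : ZMod 5) (p q : ℕ) :
    cA (i + 3) * (cA i ^ p * cA (i + 1) ^ q) ∈ Submodule.span ℤ clusterMonomials := by
  cases q with
  | succ q =>
    have hrel := cA_mul_cA_add_two (i + 1)
    rw [show i + 1 + 2 = i + 3 by ring, show i + 1 + 1 = i + 2 by ring] at hrel
    convert add_mem (monomial_mem_span i p q) (cA_add_two_mul_monomial_mem_span i p q) using 1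
    linear_combination cA i ^ p * cA (i + 1) ^ q * hrel
  | zero =>
    cases p with
    | zero =>
      convert monomial_mem_span (i + 3) 1 0 using 1
      ring
    | succ p =>
      have hrel := cA_mul_cA_add_two (i + 3)
      rw [show i + 3 + 2 = i by linear_combination (by decide : (5 : ZMod 5) = 0),
        show i + 3 + 1 = i - 1 by linear_combination (by decide : (5 : ZMod 5) = 0)] at hrel
      convert add_mem (monomial_mem_span i p 0) (cA_sub_one_mul_monomial_mem_span i p 0) using 1
      linear_combination cA i ^ p * hrel

theorem cA_mul_monomial_mem_span (i j : ZMod 5) (p q : ℕ) :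
    cA j * (cA i ^ p * cA (i + 1) ^ q) ∈ Submodule.span ℤ clusterMonomials := by
  obtain rfl | rfl | rfl | rfl | rfl :
      j = i ∨ j = i + 1 ∨ j = i + 2 ∨ j = i + 3 ∨ j = i - 1 := by
    revert i j
    decide
  · convert monomial_mem_span j (p + 1) q using 1
    ring
  · convert monomial_mem_span i p (q + 1) using 1
    ring
  · exact cA_add_two_mul_monomial_mem_span i p q
  · exact cA_add_three_mul_monomial_mem_span i p q
  · exact cA_sub_one_mul_monomial_mem_span i p q

theorem cA_mul_mem_span (j : ZMod 5) {x : K} (hx : x ∈ Submodule.span ℤ clusterMonomials) :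
    cA j * x ∈ Submodule.span ℤ clusterMonomials := by
  induction hx using Submodule.span_induction with
  | mem x hx =>
    obtain ⟨i, p, q, rfl⟩ := hx
    exact cA_mul_monomial_mem_span i j p q
  | zero => simp
  | add x y _ _ hx hy =>
    rw [mul_add]
    exact add_mem hx hy
  | smul n x _ hx =>
    rw [mul_smul_comm]
    exact Submodule.smul_mem _ n hx

theorem mul_mem_span_of_mem_closure {x y : K} (hx : x ∈ Subring.closure (Set.range cA))
    (hy : y ∈ Submodule.span ℤ clusterMonomials) :
    x * y ∈ Submodule.span ℤ clusterMonomials := by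
  induction hx using Subring.closure_induction generalizing y with
  | mem x hx =>
    obtain ⟨j, rfl⟩ := hx
    exact cA_mul_mem_span j hy
  | zero => simp
  | one => simpa
  | add u v _ _ hu hv =>
    rw [add_mul]
    exact add_mem (hu hy) (hv hy)
  | neg u _ hu =>
    rw [neg_mul]
    exact neg_mem (hu hy)
  | mul u v _ _ hu hv =>
    rw [mul_assoc]
    exact hu (hv hy)

theorem clusterMonomials_subset_closure :
    clusterMonomials ⊆ (Subring.closure (Set.range cA) : Set K) := by
  rintro _ ⟨i, p, q, rfl⟩
  have hmem (j : ZMod 5) : cA j ∈ Subring.closure (Set.range cA) :=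
    Subring.subset_closure (Set.mem_range_self j)
  exact mul_mem (pow_mem (hmem i) p) (pow_mem (hmem (i + 1)) q)

theorem span_clusterMonomials :
    (Submodule.span ℤ clusterMonomials : Set K) =
      (Subring.closure (Set.range cA) : Set K) := by
  apply Set.Subset.antisymm
  · intro x hx
    induction hx using Submodule.span_induction with
    | mem x hx => exact clusterMonomials_subset_closure hx
    | zero => exact zero_mem (Subring.closure (Set.range cA))
    | add x y _ _ hx hy => exact add_mem (SetLike.mem_coe.1 hx) (SetLike.mem_coe.1 hy)
    | smul n x _ hx => exact zsmul_mem (SetLike.mem_coe.1 hx) n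
  · intro x hx
    have hone : (1 : K) ∈ Submodule.span ℤ clusterMonomials := by
      simpa using monomial_mem_span 0 0 0
    simpa using mul_mem_span_of_mem_closure hx hone

/-- Property (A1) in type `A_2`: the cluster monomials form a `ℤ`-linear basis of
the cluster algebra `A` (the subring of `K` generated by `c_1, …, c_5`): they are
`ℤ`-linearly independent and their `ℤ`-span equals `A`. -/
theorem typeA_cluster_monomials_basis :
    LinearIndependent ℤ ((↑) : clusterMonomials → K) ∧
    (Submodule.span ℤ clusterMonomials : Set K) =
      (Subring.closure (Set.range cA) : Set K) := by
  exact ⟨linearIndependent_clusterMonomials, span_clusterMonomials⟩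
end
end

section
/- Let M be an additive commutative group and let B and B' be subsets of M, each of which is a basis of M as a ℤ-module (that is, every element of M has a unique expression as a finite ℤ-linear combination of elements of B, and likewise for B'). If the set of finite ℕ-linear combinations of elements of B equals the set of finite ℕ-linear combinations of elements of B', then B = B'. (This is the paper's observation that if an atomic basis of a cluster algebra exists, then it is unique.) -/
/-- The set of finite `ℕ`-linear combinations of elements of `B`. -/
def natCone {M : Type*} [AddCommGroup M] (B : Set M) : Set M :=
  {x | ∃ c : M →₀ ℕ, ↑c.support ⊆ B ∧ x = c.sum fun e k => k • e}

theorem subset_natCone {M : Type*} [AddCommGroup M] (B : Set M) : B ⊆ natCone B := by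
  intro b hb
  refine ⟨Finsupp.single b 1, ?_, by simp⟩
  exact (Finset.coe_subset.2 Finsupp.support_single_subset).trans (by simpa using hb)

/-- Over a linearly independent set, `ℕ`-linear combinations have unique coefficients. -/
theorem LinearIndependent.natCone_coeff_unique {M : Type*} [AddCommGroup M] {B : Set M}
    (hB : LinearIndependent ℤ ((↑) : B → M)) {c d : M →₀ ℕ}
    (hc : ↑c.support ⊆ B) (hd : ↑d.support ⊆ B)
    (hcd : (c.sum fun e k => k • e) = d.sum fun e k => k • e) : c = d := by
  have hN : LinearIndepOn ℕ id B := LinearIndependent.restrict_scalars' ℕ hB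
  exact linearIndepOn_iffₛ.1 hN c hc d hd hcd

/-- The elements of a linearly independent set are exactly the atoms of its `ℕ`-cone. -/
theorem LinearIndependent.mem_iff_atom_natCone {M : Type*} [AddCommGroup M] {B : Set M}
    (hB : LinearIndependent ℤ ((↑) : B → M)) (b : M) :
    b ∈ B ↔ b ∈ natCone B ∧ b ≠ 0 ∧
      ∀ x ∈ natCone B, ∀ y ∈ natCone B, x + y = b → x = 0 ∨ y = 0 := by
  classical
  constructor
  · intro hb
    refine ⟨subset_natCone B hb, hB.ne_zero ⟨b, hb⟩, ?_⟩
    rintro _ ⟨c, hc, rfl⟩ _ ⟨d, hd, rfl⟩ hsum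
    have hadd : c + d = Finsupp.single b 1 := by
      refine hB.natCone_coeff_unique ?_ ?_ ?_
      · refine (Finset.coe_subset.2 Finsupp.support_add).trans ?_
        simpa using ⟨hc, hd⟩
      · exact (Finset.coe_subset.2 Finsupp.support_single_subset).trans (by simpa using hb)
      · rw [Finsupp.sum_add_index' (by simp) (fun _ _ _ => add_smul _ _ _), hsum]
        simp
    have hzero : ∀ e, e ≠ b → c e = 0 ∧ d e = 0 := fun e he => by
      simpa [Finsupp.single_apply, he.symm] using DFunLike.congr_fun hadd e
    have hone : c b + d b = 1 := by simpa using DFunLike.congr_fun hadd b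
    rcases Nat.add_eq_one_iff.1 hone with h | h
    · left
      have : c = 0 := Finsupp.ext fun e => by
        by_cases he : e = b
        · exact he ▸ h.1
        · exact (hzero e he).1
      simp [this]
    · right
      have : d = 0 := Finsupp.ext fun e => by
        by_cases he : e = b
        · exact he ▸ h.2
        · exact (hzero e he).2
      simp [this]
  · rintro ⟨⟨c, hc, rfl⟩, hne, hatom⟩
    have hc0 : c ≠ 0 := by
      rintro rfl
      simp at hne
    obtain ⟨e, he⟩ := Finsupp.support_nonempty_iff.2 hc0
    have heB : e ∈ B := hc he
    have hle : Finsupp.single e 1 ≤ c := by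
      rw [Finsupp.single_le_iff]
      exact Nat.one_le_iff_ne_zero.2 (Finsupp.mem_support_iff.1 he)
    obtain ⟨d, rfl⟩ := exists_add_of_le hle
    have hd : ↑d.support ⊆ B := fun x hx => hc (by
      simp only [Finset.mem_coe, Finsupp.mem_support_iff, Finsupp.add_apply] at hx ⊢
      omega)
    have hsplit : ((Finsupp.single e 1 + d).sum fun e k => k • e) =
        e + d.sum fun e k => k • e := by
      rw [Finsupp.sum_add_index' (by simp) (fun _ _ _ => add_smul _ _ _)]
      simp
    rcases hatom e (subset_natCone B heB) _ ⟨d, hd, rfl⟩ hsplit.symm with h | h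
    · exact absurd h (hB.ne_zero ⟨e, heB⟩)
    · rwa [hsplit, h, add_zero]

/-- Uniqueness of the atomic basis: if `B` and `B'` are both `ℤ`-module bases of
an additive commutative group `M` (each is `ℤ`-linearly independent and spans `M`
over `ℤ`), and the sets of finite `ℕ`-linear combinations of elements of `B` and
of `B'` coincide, then `B = B'`. -/
theorem atomic_basis_unique {M : Type*} [AddCommGroup M] (B B' : Set M)
    (hB : LinearIndependent ℤ ((↑) : B → M) ∧ Submodule.span ℤ B = ⊤)
    (hB' : LinearIndependent ℤ ((↑) : B' → M) ∧ Submodule.span ℤ B' = ⊤)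
    (h : natCone B = natCone B') : B = B' := by
  ext b
  rw [hB.1.mem_iff_atom_natCone, hB'.1.mem_iff_atom_natCone, h]
end
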